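/- arXiv:1209.4220 — 9 statements merged into one kernel-verified Lean document; each statement's English description precedes it below -/
import Mathlib

section
/- Suppose ν satisfies conditions (A1) and (A2). Then there is a constant C₂₈ ≥ 1, depending only on ν, such that for all integers n₀ ≥ 2 and all integers n, k with n₀ ≤ k < n − 2, and for all x ∈ R_n and y ∈ D_n, one has ∫_{R_k} ν(z − y) dz ≤ C₂₈ ∫_{R_k} ν(z − x) dz. -/
open MeasureTheory

/-- The shell `R_k` relative to the base index `n₀`: for `k = n₀` or `k = n₀ + 1` it is the
closed ball of radius `k`, and for `k ≥ n₀ + 2` it is the shell `{x : k - 1 < ‖x‖ ≤ k}`. -/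
def shellR (d n₀ k : ℕ) : Set (EuclideanSpace ℝ (Fin d)) :=
  if k ≤ n₀ + 1 then {x | ‖x‖ ≤ (k : ℝ)}
  else {x | (k : ℝ) - 1 < ‖x‖ ∧ ‖x‖ ≤ (k : ℝ)}

/-- under conditions (A1) and (A2) there is `C₂₈ ≥ 1`, depending only on `ν`,
such that `∫_{R_k} ν(z-y) dz ≤ C₂₈ ∫_{R_k} ν(z-x) dz` for all `x ∈ R_n`, `y ∈ D_n`,
whenever `n₀ ≤ k < n - 2`. -/
theorem stmt1 (d : ℕ) (hd : 1 ≤ d)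
    (ν : EuclideanSpace ℝ (Fin d) → ℝ) (hνmeas : Measurable ν)
    (hνsymm : ∀ x : EuclideanSpace ℝ (Fin d), ν (-x) = ν x)
    (hνpos : ∀ x : EuclideanSpace ℝ (Fin d), x ≠ 0 → 0 < ν x)
    -- condition (A1)
    (hA1 : ∀ r : ℝ, 0 < r → r ≤ 1/2 → ∃ C₁ : ℝ, 1 ≤ C₁ ∧
      ∀ x y : EuclideanSpace ℝ (Fin d), r ≤ ‖y‖ → ‖y‖ ≤ ‖x‖ → ‖x‖ ≤ ‖y‖ + 1 →
        C₁⁻¹ * ν y ≤ ν x ∧ ν x ≤ C₁ * ν y)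
    -- condition (A2)
    (hA2 : ∃ C₂ : ℝ, 1 ≤ C₂ ∧
      ∀ x y : EuclideanSpace ℝ (Fin d), 1/2 ≤ ‖y‖ → ‖y‖ ≤ ‖x‖ → ν x ≤ C₂ * ν y) :
    ∃ C₂₈ : ℝ, 1 ≤ C₂₈ ∧
      ∀ n₀ n k : ℕ, 2 ≤ n₀ → n₀ ≤ k → k + 2 < n →
        ∀ x y : EuclideanSpace ℝ (Fin d),
          -- `x ∈ R_n` (here `n ≥ n₀ + 3`, so `R_n` is the shell)
          x ∈ shellR d n₀ n →
          -- `y ∈ D_n = {z : ‖z‖ > n - 2}`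
          (n : ℝ) - 2 < ‖y‖ →
          ∫ z in shellR d n₀ k, ν (z - y) ≤ C₂₈ * ∫ z in shellR d n₀ k, ν (z - x) := by
  obtain ⟨C₁, hC₁, h1⟩ := hA1 (1/2) (by norm_num) le_rfl
  obtain ⟨C₂, hC₂, h2⟩ := hA2
  have hnn : ∀ v : EuclideanSpace ℝ (Fin d), 1/2 ≤ ‖v‖ → 0 < ν v := fun v hv =>
    hνpos v (norm_pos_iff.1 (by linarith))
  have key : ∀ u v : EuclideanSpace ℝ (Fin d), 1/2 ≤ ‖u‖ → 1/2 ≤ ‖v‖ → ‖v‖ ≤ ‖u‖ + 2 →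
      ν u ≤ (C₁ * C₁ * C₂) * ν v := by
    intro u v hu hv huv
    have hvp := hnn v hv
    have e1 : C₁ ≤ C₁ * C₁ * C₂ := by nlinarith [mul_nonneg (sub_nonneg.2 hC₁) (sub_nonneg.2 hC₂)]
    have e2 : C₂ ≤ C₁ * C₁ * C₂ := by nlinarith [mul_nonneg (sub_nonneg.2 hC₁) (sub_nonneg.2 hC₁)]
    have e3 : C₁ * C₁ ≤ C₁ * C₁ * C₂ := by nlinarith
    have flip : ∀ a b : EuclideanSpace ℝ (Fin d), 1/2 ≤ ‖a‖ → ‖a‖ ≤ ‖b‖ → ‖b‖ ≤ ‖a‖ + 1 →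
        ν a ≤ C₁ * ν b := by
      intro a b ha hab hab1
      have := (h1 b a ha hab hab1).1
      rwa [inv_mul_le_iff₀ (by linarith)] at this
    rcases le_total ‖v‖ ‖u‖ with h | h
    · exact (h2 u v hv h).trans (by gcongr)
    rcases le_total ‖v‖ (‖u‖ + 1) with h' | h'
    · exact (flip u v hu h h').trans (by gcongr)
    have hu0 : 0 < ‖u‖ := by linarith
    have hw : ‖((‖u‖ + 1) / ‖u‖) • u‖ = ‖u‖ + 1 := by
      rw [norm_smul, Real.norm_of_nonneg (by positivity)]
      field_simp
    have g1 := flip u (((‖u‖ + 1) / ‖u‖) • u) hu (by linarith) (by linarith)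
    have g2 := flip (((‖u‖ + 1) / ‖u‖) • u) v (by linarith) (by linarith) (by linarith)
    calc ν u ≤ C₁ * (C₁ * ν v) := g1.trans (by gcongr)
      _ = (C₁ * C₁) * ν v := by ring
      _ ≤ _ := by gcongr
  refine ⟨C₁ * C₁ * C₂, by nlinarith [mul_nonneg (sub_nonneg.2 hC₁) (sub_nonneg.2 hC₁)], ?_⟩
  intro n₀ n k hn₀ hk hkn x y hx hy
  have hkn' : (k : ℝ) + 3 ≤ n := by exact_mod_cast hkn
  have hk0 : (0 : ℝ) ≤ k := Nat.cast_nonneg k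
  rw [shellR, if_neg (by omega)] at hx
  obtain ⟨hx1, hx2⟩ := hx
  have hxp : 0 < ‖x‖ := by linarith
  have hsub : ∀ z ∈ shellR d n₀ k, ‖z‖ ≤ (k : ℝ) := by
    intro z hz
    unfold shellR at hz
    split_ifs at hz
    · exact hz
    · exact hz.2
  have hmS : MeasurableSet (shellR d n₀ k) := by
    unfold shellR
    split_ifs
    · exact measurableSet_le measurable_norm measurable_const
    · exact (measurableSet_lt measurable_const measurable_norm).inter
        (measurableSet_le measurable_norm measurable_const)
  have hfin : volume (shellR d n₀ k) < ⊤ :=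
    lt_of_le_of_lt (measure_mono (fun z hz => mem_closedBall_zero_iff.2 (hsub z hz)))
      (measure_closedBall_lt_top (x := (0 : EuclideanSpace ℝ (Fin d))) (r := (k : ℝ)))
  -- the rotation
  set y' : EuclideanSpace ℝ (Fin d) := (‖y‖ / ‖x‖) • x with hy'
  have hny' : ‖y'‖ = ‖y‖ := by
    rw [hy', norm_smul, Real.norm_of_nonneg (by positivity)]
    field_simp
  obtain ⟨U, hU⟩ : ∃ U : EuclideanSpace ℝ (Fin d) ≃ₗᵢ[ℝ] EuclideanSpace ℝ (Fin d), U y' = y :=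
    ⟨_, Submodule.reflection_sub hny'⟩
  have hpre : U ⁻¹' (shellR d n₀ k) = shellR d n₀ k := by
    ext z
    unfold shellR
    split_ifs <;> simp
  have hrot : ∫ z in shellR d n₀ k, ν (z - y) = ∫ z in shellR d n₀ k, ν (U z - y) := by
    have := (U.measurePreserving).setIntegral_preimage_emb
      U.toHomeomorph.measurableEmbedding (fun z => ν (z - y)) (shellR d n₀ k)
    rw [hpre] at this
    exact this.symm
  rw [hrot, ← integral_const_mul]
  have hzx : ∀ z ∈ shellR d n₀ k, 1/2 ≤ ‖z - x‖ := by
    intro z hz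
    have a := hsub z hz
    have b := norm_sub_norm_le x z
    rw [norm_sub_rev] at b
    linarith
  have hzy : ∀ z ∈ shellR d n₀ k, 1/2 ≤ ‖z - y'‖ := by
    intro z hz
    have a := hsub z hz
    have b := norm_sub_norm_le y' z
    rw [norm_sub_rev] at b
    linarith
  have hUn : ∀ z, ‖U z - y‖ = ‖z - y'‖ := by
    intro z
    rw [← hU, ← map_sub, U.norm_map]
  have hcomp : ∀ z ∈ shellR d n₀ k, ‖z - x‖ ≤ ‖z - y'‖ + 2 := by
    intro z hz
    have a := hsub z hz
    rcases le_total ‖x‖ ‖y‖ with h | h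
    · have hs : 1 ≤ ‖y‖ / ‖x‖ := (one_le_div hxp).2 h
      have hin : inner ℝ z x ≤ ‖x‖ * ‖x‖ :=
        (real_inner_le_norm z x).trans (by gcongr; linarith)
      have : ‖z - x‖ ≤ ‖z - y'‖ := by
        refine le_of_sq_le_sq ?_ (norm_nonneg _)
        rw [@norm_sub_sq_real, @norm_sub_sq_real, hy', inner_smul_right, norm_smul,
          Real.norm_of_nonneg (by positivity)]
        generalize ‖y‖ / ‖x‖ = s at *
        have : 0 ≤ (s - 1) * ((s + 1) * (‖x‖ * ‖x‖) - 2 * inner ℝ z x) := by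
          apply mul_nonneg (by linarith)
          nlinarith [mul_nonneg (sub_nonneg.2 hs) (mul_self_nonneg ‖x‖)]
        nlinarith
      linarith
    · have e : ‖y' - x‖ = ‖x‖ - ‖y‖ := by
        have : y' - x = -((1 - ‖y‖ / ‖x‖) • x) := by rw [hy']; module
        rw [this, norm_neg, norm_smul, Real.norm_of_nonneg
          (sub_nonneg.2 ((div_le_one hxp).2 h))]
        field_simp
      have b := norm_sub_le_norm_sub_add_norm_sub z y' x
      linarith
  have hint : IntegrableOn (fun z => ν (z - x)) (shellR d n₀ k) := by
    have hw : ‖(1 / (2 * ‖x‖)) • x‖ = 1/2 := by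
      rw [norm_smul, Real.norm_of_nonneg (by positivity)]
      field_simp
    refine Measure.integrableOn_of_bounded (M := C₂ * ν ((1 / (2 * ‖x‖)) • x)) hfin.ne
      (hνmeas.comp (measurable_id.sub_const x)).aestronglyMeasurable ?_
    filter_upwards [ae_restrict_mem hmS] with z hz
    rw [Real.norm_of_nonneg (hnn _ (hzx z hz)).le]
    exact h2 _ _ hw.ge (hw.le.trans (hzx z hz))
  refine integral_mono_of_nonneg ?_ (hint.const_mul _) ?_
  · filter_upwards [ae_restrict_mem hmS] with z hz
    exact (hnn _ ((hzy z hz).trans (hUn z).ge)).le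
  · filter_upwards [ae_restrict_mem hmS] with z hz
    exact key _ _ ((hzy z hz).trans (hUn z).ge) (hzx z hz) (by rw [hUn]; exact hcomp z hz)
end

section
/- Suppose ν satisfies conditions (A1) and (A2). Then for every integer m ≥ 1 there is a constant C₂₉ = C₂₉(m) ≥ 1, depending only on ν and m, such that for all integers n₀ ≥ 2 and k ≥ n₀ and every y ∈ ℝ^d with |y| ≥ k + 1, one has ∫_{R_{k+m} ∩ {z : |y−z| > 1/2}} ν(z − y) dz ≤ C₂₉ ∫_{R_k} ν(z − y) dz. -/
open MeasureTheory

/-- Iterated form of (A1). -/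
theorem chainA1 {d : ℕ} (ν : EuclideanSpace ℝ (Fin d) → ℝ) (C₁ : ℝ) (hC : 1 ≤ C₁)
    (h : ∀ x y : EuclideanSpace ℝ (Fin d), 1/2 ≤ ‖y‖ → ‖y‖ ≤ ‖x‖ → ‖x‖ ≤ ‖y‖ + 1 →
        ν y ≤ C₁ * ν x) (m : ℕ) :
    ∀ x y : EuclideanSpace ℝ (Fin d), 1/2 ≤ ‖y‖ → ‖y‖ ≤ ‖x‖ → ‖x‖ ≤ ‖y‖ + ((m : ℝ) + 1) →
        ν y ≤ C₁ ^ (m + 1) * ν x := by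
  induction m with
  | zero =>
    intro x y h1 h2 h3
    simpa using h x y h1 h2 (by simpa using h3)
  | succ m ih =>
    intro x y h1 h2 h3
    push_cast at h3
    have hy : 0 < ‖y‖ := by linarith
    set t : ℝ := min ‖x‖ (‖y‖ + 1) with ht
    have ht1 : ‖y‖ ≤ t := le_min h2 (by linarith)
    have ht2 : t ≤ ‖y‖ + 1 := min_le_right _ _
    have ht3 : t ≤ ‖x‖ := min_le_left _ _
    have ht4 : ‖x‖ ≤ t + ((m : ℝ) + 1) := by
      have hm : (0 : ℝ) ≤ m := Nat.cast_nonneg m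
      rcases min_choice ‖x‖ (‖y‖ + 1) with hc | hc <;> rw [ht, hc] <;> linarith
    have hw : ‖(t / ‖y‖) • y‖ = t := by
      rw [norm_smul, Real.norm_of_nonneg (by positivity)]
      field_simp
    have a := h ((t / ‖y‖) • y) y h1 (by rw [hw]; exact ht1) (by rw [hw]; exact ht2)
    have b := ih x ((t / ‖y‖) • y) (by rw [hw]; linarith) (by rw [hw]; exact ht3)
      (by rw [hw]; exact ht4)
    calc ν y ≤ C₁ * ν ((t / ‖y‖) • y) := a
      _ ≤ C₁ * (C₁ ^ (m + 1) * ν x) := by gcongr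
      _ = _ := by ring

theorem shellR_meas (d n₀ k : ℕ) : MeasurableSet (shellR d n₀ k) := by
  unfold shellR
  split_ifs
  · exact measurableSet_le measurable_norm measurable_const
  · exact (measurableSet_lt measurable_const measurable_norm).inter
      (measurableSet_le measurable_norm measurable_const)

theorem shellR_le {d n₀ k : ℕ} {z : EuclideanSpace ℝ (Fin d)} (h : z ∈ shellR d n₀ k) :
    ‖z‖ ≤ k := by
  unfold shellR at h
  split_ifs at h
  · exact h
  · exact h.2

theorem shellR_smul {d n₀ k m : ℕ} (hk : 1 ≤ k) (hm : 1 ≤ m) {z : EuclideanSpace ℝ (Fin d)}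
    (h : z ∈ shellR d n₀ (k + m)) : ((k : ℝ) / (k + m)) • z ∈ shellR d n₀ k := by
  have hk0 : (0 : ℝ) < k := by exact_mod_cast hk
  have hm0 : (0 : ℝ) < m := by exact_mod_cast hm
  have hn : ‖((k : ℝ) / (k + m)) • z‖ = (k : ℝ) / (k + m) * ‖z‖ := by
    rw [norm_smul, Real.norm_of_nonneg (by positivity)]
  have hle := shellR_le h
  push_cast at hle
  have h1 : ‖((k : ℝ) / (k + m)) • z‖ ≤ k := by
    rw [hn, div_mul_eq_mul_div, div_le_iff₀ (by positivity)]
    gcongr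
  unfold shellR at h ⊢
  by_cases c : k ≤ n₀ + 1
  · rw [if_pos c]; exact h1
  · rw [if_neg c]
    rw [if_neg (by omega)] at h
    refine ⟨?_, h1⟩
    have h2 := h.1
    push_cast at h2
    rw [hn, div_mul_eq_mul_div, lt_div_iff₀ (by positivity)]
    nlinarith

/-- under conditions (A1) and (A2), for every `m ≥ 1` there is a constant
`C₂₉ = C₂₉(m) ≥ 1` such that for all `n₀ ≥ 2`, `k ≥ n₀` and every `y` with `‖y‖ ≥ k + 1`,
`∫_{R_{k+m} ∩ {z : ‖y-z‖ > 1/2}} ν(z-y) dz ≤ C₂₉ ∫_{R_k} ν(z-y) dz`. -/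
theorem stmt2 (d : ℕ) (hd : 1 ≤ d)
    (ν : EuclideanSpace ℝ (Fin d) → ℝ) (hνmeas : Measurable ν)
    (hνsymm : ∀ x : EuclideanSpace ℝ (Fin d), ν (-x) = ν x)
    (hνpos : ∀ x : EuclideanSpace ℝ (Fin d), x ≠ 0 → 0 < ν x)
    -- condition (A1)
    (hA1 : ∀ r : ℝ, 0 < r → r ≤ 1/2 → ∃ C₁ : ℝ, 1 ≤ C₁ ∧
      ∀ x y : EuclideanSpace ℝ (Fin d), r ≤ ‖y‖ → ‖y‖ ≤ ‖x‖ → ‖x‖ ≤ ‖y‖ + 1 →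
        C₁⁻¹ * ν y ≤ ν x ∧ ν x ≤ C₁ * ν y)
    -- condition (A2)
    (hA2 : ∃ C₂ : ℝ, 1 ≤ C₂ ∧
      ∀ x y : EuclideanSpace ℝ (Fin d), 1/2 ≤ ‖y‖ → ‖y‖ ≤ ‖x‖ → ν x ≤ C₂ * ν y) :
    ∀ m : ℕ, 1 ≤ m → ∃ C₂₉ : ℝ, 1 ≤ C₂₉ ∧
      ∀ n₀ k : ℕ, 2 ≤ n₀ → n₀ ≤ k →
        ∀ y : EuclideanSpace ℝ (Fin d), (k : ℝ) + 1 ≤ ‖y‖ →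
          ∫ z in shellR d n₀ (k + m) ∩ {z | 1/2 < ‖y - z‖}, ν (z - y) ≤
            C₂₉ * ∫ z in shellR d n₀ k, ν (z - y) := by
  intro m hm
  obtain ⟨C₁, hC₁, h1⟩ := hA1 (1/2) (by norm_num) le_rfl
  obtain ⟨C₂, hC₂, h2⟩ := hA2
  have hstep : ∀ x y : EuclideanSpace ℝ (Fin d), 1/2 ≤ ‖y‖ → ‖y‖ ≤ ‖x‖ → ‖x‖ ≤ ‖y‖ + 1 →
      ν y ≤ C₁ * ν x := by
    intro x y a b c
    have := (h1 x y a b c).1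
    rwa [inv_mul_le_iff₀ (by linarith)] at this
  obtain ⟨p, rfl⟩ : ∃ p, m = p + 1 := ⟨m - 1, by omega⟩
  have hch := chainA1 ν C₁ hC₁ hstep p
  set m := p + 1 with hmdef
  have hCm : 1 ≤ C₁ ^ m := one_le_pow₀ hC₁
  have hm0 : (1 : ℝ) ≤ m := by exact_mod_cast hm
  have hD : 1 ≤ C₁ ^ m * C₂ := one_le_mul_of_one_le_of_one_le hCm hC₂
  refine ⟨C₁ ^ m * C₂ * (1 + m) ^ d,
    one_le_mul_of_one_le_of_one_le hD (one_le_pow₀ (by linarith)), ?_⟩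
  intro n₀ k hn₀ hk y hy
  have hk2 : (2 : ℝ) ≤ k := by exact_mod_cast hn₀.trans hk
  set l : ℝ := (k : ℝ) / (k + m) with hl
  have hl0 : 0 < l := by positivity
  set A : Set (EuclideanSpace ℝ (Fin d)) := shellR d n₀ (k + m) ∩ {z | 1/2 < ‖y - z‖} with hA
  have hAm : MeasurableSet A := (shellR_meas _ _ _).inter
    (measurableSet_lt measurable_const (by fun_prop))
  have hRm := shellR_meas d n₀ k
  have hfar : ∀ w ∈ shellR d n₀ k, 1 ≤ ‖w - y‖ := by
    intro w hw
    have a := shellR_le hw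
    have b := norm_sub_norm_le y w
    rw [norm_sub_rev] at b
    linarith
  have hpos : ∀ x : EuclideanSpace ℝ (Fin d), 1/2 ≤ ‖x‖ → 0 < ν x := by
    intro x hx
    apply hνpos
    rintro rfl
    norm_num at hx
  set f : EuclideanSpace ℝ (Fin d) → ℝ := (shellR d n₀ k).indicator (fun w => ν (w - y)) with hf
  have hf0 : ∀ w, 0 ≤ f w := by
    intro w
    apply Set.indicator_nonneg
    intro w hw
    exact (hpos _ (by linarith [hfar w hw])).le
  have hy0 : 0 < ‖y‖ := by linarith
  have hfi : Integrable f := by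
    rw [hf, integrable_indicator_iff hRm]
    have hunit : ‖(‖y‖⁻¹) • y‖ = 1 := by
      rw [norm_smul, norm_inv, norm_norm, inv_mul_cancel₀ hy0.ne']
    have hfin : volume (shellR d n₀ k) < ⊤ := by
      refine lt_of_le_of_lt (measure_mono (t := Metric.closedBall 0 (k : ℝ)) ?_)
        measure_closedBall_lt_top
      intro z hz
      simpa using shellR_le hz
    refine Measure.integrableOn_of_bounded (M := C₂ * ν (‖y‖⁻¹ • y)) hfin.ne ?_ ?_
    · exact (hνmeas.comp (measurable_id.sub_const y)).aestronglyMeasurable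
    · refine (ae_restrict_iff' hRm).2 (Filter.Eventually.of_forall ?_)
      intro w hw
      have := hfar w hw
      rw [Real.norm_of_nonneg (hpos _ (by linarith)).le]
      exact h2 _ _ (by rw [hunit]; norm_num) (by rw [hunit]; exact this)
  have key : ∀ z, A.indicator (fun z => ν (z - y)) z ≤ C₁ ^ m * C₂ * f (l • z) := by
    intro z
    by_cases hz : z ∈ A
    · rw [Set.indicator_of_mem hz]
      have hw : l • z ∈ shellR d n₀ k :=
        shellR_smul (by omega) hm hz.1
      have hz1 : 1/2 < ‖z - y‖ := by
        rw [norm_sub_rev]; exact hz.2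
      have hw1 := hfar _ hw
      have hwp := hpos (l • z - y) (by linarith)
      rw [hf, Set.indicator_of_mem hw]
      rcases le_total ‖l • z - y‖ ‖z - y‖ with c | c
      · calc ν (z - y) ≤ C₂ * ν (l • z - y) := h2 _ _ (by linarith) c
          _ ≤ _ := by
            gcongr
            nlinarith
      · have hle := shellR_le hz.1
        push_cast at hle
        have hd1 : ‖l • z - z‖ ≤ m := by
          have : l • z - z = (-((m : ℝ) / (k + m))) • z := by
            have : l = 1 - (m : ℝ) / (k + m) := by
              rw [hl]; field_simp; ring
            rw [this]; module
          rw [this, norm_smul, norm_neg, Real.norm_of_nonneg (by positivity),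
            div_mul_eq_mul_div, div_le_iff₀ (by positivity)]
          gcongr
        have hd2 : ‖l • z - y‖ ≤ ‖z - y‖ + m := by
          have := norm_add_le (z - y) (l • z - z)
          rw [show z - y + (l • z - z) = l • z - y by abel] at this
          linarith
        calc ν (z - y) ≤ C₁ ^ m * ν (l • z - y) :=
              hch _ _ hz1.le c (by rw [hmdef] at hd2; push_cast at hd2; exact hd2)
          _ ≤ _ := by
            gcongr
            nlinarith
    · rw [Set.indicator_of_notMem hz]
      exact mul_nonneg (by linarith) (hf0 _)
  have hA0 : ∀ z, 0 ≤ A.indicator (fun z => ν (z - y)) z := by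
    intro z
    apply Set.indicator_nonneg
    intro z hz
    refine (hpos _ ?_).le
    rw [norm_sub_rev]; exact (hz.2 : 1/2 < ‖y - z‖).le
  have hint : ∫ z, f (l • z) = |(l ^ d)⁻¹| * ∫ z, f z := by
    have := Measure.integral_comp_smul (volume : Measure (EuclideanSpace ℝ (Fin d))) f l
    simpa using this
  have hlb : |(l ^ d)⁻¹| ≤ (1 + (m : ℝ)) ^ d := by
    rw [abs_of_nonneg (by positivity), ← inv_pow]
    gcongr
    rw [hl, inv_div, div_le_iff₀ (by positivity)]
    nlinarith
  have hI0 : 0 ≤ ∫ z, f z := integral_nonneg hf0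
  rw [← integral_indicator hAm, ← integral_indicator hRm]
  calc ∫ z, A.indicator (fun z => ν (z - y)) z
      ≤ ∫ z, C₁ ^ m * C₂ * f (l • z) :=
        integral_mono_of_nonneg (Filter.Eventually.of_forall hA0)
          ((hfi.comp_smul hl0.ne').const_mul _) (Filter.Eventually.of_forall key)
    _ = C₁ ^ m * C₂ * (|(l ^ d)⁻¹| * ∫ z, f z) := by rw [integral_const_mul, hint]
    _ ≤ C₁ ^ m * C₂ * ((1 + (m : ℝ)) ^ d * ∫ z, f z) := by gcongr
    _ = _ := by ring
end

section
/- Let d ≥ 1, α ∈ [0,2) and β > 0, and define ν(x) = |x|^{−d−α} (1 + |x|)^{α−β} for x ∈ ℝ^d \ {0}. Then ν satisfies conditions (A1), (A2) and (A3). -/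
open MeasureTheory

lemma nu_bounds (a b g r t : ℝ) (ha : 0 ≤ a) (hr : 0 < r) (ht : r ≤ t) (hg : -a + b = -g) :
    (1 + t) ^ (-g) ≤ t ^ (-a) * (1 + t) ^ b ∧
    t ^ (-a) * (1 + t) ^ b ≤ (r / (1 + r)) ^ (-a) * (1 + t) ^ (-g) := by
  have ht0 : 0 < t := hr.trans_le ht
  have h1 : 0 < 1 + t := by linarith
  have e : t ^ (-a) * (1 + t) ^ b = (t / (1 + t)) ^ (-a) * (1 + t) ^ (-g) := by
    rw [Real.div_rpow ht0.le h1.le, ← hg, Real.rpow_add h1]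
    have := (Real.rpow_pos_of_pos h1 (-a)).ne'
    field_simp
  have hw : 0 ≤ (1 + t) ^ (-g) := (Real.rpow_pos_of_pos h1 _).le
  rw [e]
  constructor
  · have : 1 ≤ (t / (1 + t)) ^ (-a) :=
      Real.one_le_rpow_of_pos_of_le_one_of_nonpos (by positivity)
        (by rw [div_le_one h1]; linarith) (by linarith)
    nlinarith
  · apply mul_le_mul_of_nonneg_right _ hw
    apply Real.rpow_le_rpow_of_nonpos (by positivity) _ (by linarith)
    rw [div_le_div_iff₀ (by linarith) h1]
    nlinarith

lemma K_ge (a r : ℝ) (ha : 0 ≤ a) (hr : 0 < r) : 1 ≤ (r / (1 + r)) ^ (-a) :=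
  Real.one_le_rpow_of_pos_of_le_one_of_nonpos (by positivity)
    (by rw [div_le_one (by linarith)]; linarith) (by linarith)

lemma w_double (g s t : ℝ) (hg : 0 ≤ g) (hs : 0 ≤ s) (ht : 0 ≤ t) (h : 1 + t ≤ 2 * (1 + s)) :
    (1 + s) ^ (-g) ≤ 2 ^ g * (1 + t) ^ (-g) := by
  have : (2 * (1 + s)) ^ (-g) ≤ (1 + t) ^ (-g) :=
    Real.rpow_le_rpow_of_nonpos (by linarith) h (by linarith)
  rw [Real.mul_rpow (by norm_num) (by linarith), Real.rpow_neg (by norm_num)] at this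
  have h2 : (0:ℝ) < 2 ^ g := Real.rpow_pos_of_pos (by norm_num) _
  have := mul_le_mul_of_nonneg_left this h2.le
  rwa [← mul_assoc, mul_inv_cancel₀ h2.ne', one_mul] at this


set_option maxHeartbeats 1000000 in
/-- for `d ≥ 1`, `α ∈ [0,2)`, `β > 0`, the jump intensity
`ν(x) = |x|^{-d-α} (1+|x|)^{α-β}` satisfies conditions (A1), (A2) and (A3). -/
theorem stmt3 (d : ℕ) (hd : 1 ≤ d) (α β : ℝ) (hα0 : 0 ≤ α) (hα2 : α < 2) (hβ : 0 < β)
    (ν : EuclideanSpace ℝ (Fin d) → ℝ)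
    (hν : ∀ x : EuclideanSpace ℝ (Fin d),
      ν x = ‖x‖ ^ (-(d : ℝ) - α) * (1 + ‖x‖) ^ (α - β)) :
    -- condition (A1)
    (∀ r : ℝ, 0 < r → r ≤ 1/2 → ∃ C₁ : ℝ, 1 ≤ C₁ ∧
      ∀ x y : EuclideanSpace ℝ (Fin d), r ≤ ‖y‖ → ‖y‖ ≤ ‖x‖ → ‖x‖ ≤ ‖y‖ + 1 →
        C₁⁻¹ * ν y ≤ ν x ∧ ν x ≤ C₁ * ν y) ∧
    -- condition (A2)
    (∃ C₂ : ℝ, 1 ≤ C₂ ∧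
      ∀ x y : EuclideanSpace ℝ (Fin d), 1/2 ≤ ‖y‖ → ‖y‖ ≤ ‖x‖ → ν x ≤ C₂ * ν y) ∧
    -- condition (A3)
    (∃ C₃ : ℝ, 1 ≤ C₃ ∧
      ∀ x y : EuclideanSpace ℝ (Fin d), 1 ≤ ‖y - x‖ →
        ∫ z in {z : EuclideanSpace ℝ (Fin d) | 1/2 < ‖z - x‖ ∧ 1/2 < ‖z - y‖},
          ν (x - z) * ν (z - y) ≤ C₃ * ν (x - y)) := by
  have hd0 : (0:ℝ) ≤ d := Nat.cast_nonneg d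
  have ha : 0 ≤ (d:ℝ) + α := by linarith
  obtain ⟨g, hgdef⟩ : ∃ g : ℝ, g = d + β := ⟨_, rfl⟩
  have hg : 0 ≤ g := by linarith
  have key := fun (r : ℝ) (x : EuclideanSpace ℝ (Fin d)) (hr : 0 < r) (hx : r ≤ ‖x‖) =>
    nu_bounds (d + α) (α - β) g r ‖x‖ ha hr hx (by rw [hgdef]; ring)
  have hν' : ∀ x, ν x = ‖x‖ ^ (-((d:ℝ) + α)) * (1 + ‖x‖) ^ (α - β) := by
    intro x; rw [hν x]; congr 2; ring
  simp only [← hν'] at key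
  have h2 : (1:ℝ) ≤ 2 ^ g := Real.one_le_rpow (by norm_num) hg
  have wanti : ∀ x y : EuclideanSpace ℝ (Fin d), ‖y‖ ≤ ‖x‖ →
      (1 + ‖x‖) ^ (-g) ≤ (1 + ‖y‖) ^ (-g) := fun x y h =>
    Real.rpow_le_rpow_of_nonpos (by positivity) (by linarith) (by linarith)
  have wpos : ∀ x : EuclideanSpace ℝ (Fin d), 0 < (1 + ‖x‖) ^ (-g) := fun x =>
    Real.rpow_pos_of_pos (by positivity) _
  refine ⟨?_, ?_, ?_⟩
  · intro r hr hr2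
    have hK := K_ge (d + α) r ha hr
    set K := (r / (1 + r)) ^ (-((d:ℝ) + α))
    refine ⟨K * 2 ^ g, by nlinarith, ?_⟩
    intro x y hy hyx hxy
    obtain ⟨x1, x2⟩ := key r x hr (hy.trans hyx)
    obtain ⟨y1, y2⟩ := key r y hr hy
    have d1 := w_double g ‖y‖ ‖x‖ hg (norm_nonneg _) (norm_nonneg _)
      (by linarith [norm_nonneg y])
    have wa := wanti x y hyx
    have wx := wpos x
    have wy := wpos y
    constructor
    · rw [inv_mul_le_iff₀ (by positivity)]
      calc ν y ≤ K * (1 + ‖y‖) ^ (-g) := y2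
        _ ≤ K * (2 ^ g * (1 + ‖x‖) ^ (-g)) := by gcongr
        _ ≤ K * (2 ^ g * ν x) := by gcongr
        _ = _ := by ring
    · calc ν x ≤ K * (1 + ‖x‖) ^ (-g) := x2
        _ ≤ K * ν y := by gcongr; linarith
        _ ≤ K * 2 ^ g * ν y := by
          have : 0 < ν y := by linarith
          gcongr
          nlinarith
  · have hK := K_ge (d + α) (1/2) ha (by norm_num)
    refine ⟨_, hK, ?_⟩
    intro x y hy hyx
    obtain ⟨x1, x2⟩ := key (1/2) x (by norm_num) (hy.trans hyx)
    obtain ⟨y1, y2⟩ := key (1/2) y (by norm_num) hy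
    refine x2.trans ?_
    gcongr
    exact (wanti x y hyx).trans y1
  · have hK := K_ge (d + α) (1/2) ha (by norm_num)
    have key2 := fun x hx => key (1/2) x (by norm_num) hx
    clear key
    set K := ((1/2:ℝ) / (1 + 1/2)) ^ (-((d:ℝ) + α))
    have hI : Integrable (fun z : EuclideanSpace ℝ (Fin d) => (1 + ‖z‖) ^ (-g)) :=
      integrable_one_add_norm (by simp [hgdef, hβ])
    have hI0 : 0 ≤ ∫ z : EuclideanSpace ℝ (Fin d), (1 + ‖z‖) ^ (-g) :=
      integral_nonneg fun z => (wpos z).le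
    set I := ∫ z : EuclideanSpace ℝ (Fin d), (1 + ‖z‖) ^ (-g) with hIdef
    have hK2 : 1 ≤ K * K * 2 ^ g := by
      have : 1 ≤ K * K := by nlinarith
      nlinarith
    refine ⟨K * K * 2 ^ g * (2 * I + 1), by nlinarith, ?_⟩
    intro x y hxy
    have hxy' : 1/2 ≤ ‖x - y‖ := by rw [norm_sub_rev]; linarith
    have i1 := hI.comp_sub_left x
    have i2 := hI.comp_sub_right y
    have hF : Integrable (fun z => K * K * 2 ^ g * (1 + ‖x - y‖) ^ (-g) *
        ((1 + ‖x - z‖) ^ (-g) + (1 + ‖z - y‖) ^ (-g))) := (i1.add i2).const_mul _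
    have hS : MeasurableSet
        {z : EuclideanSpace ℝ (Fin d) | 1/2 < ‖z - x‖ ∧ 1/2 < ‖z - y‖} := by
      have o1 : IsOpen {z : EuclideanSpace ℝ (Fin d) | 1/2 < ‖z - x‖} :=
        isOpen_lt (by fun_prop) (by fun_prop)
      have o2 : IsOpen {z : EuclideanSpace ℝ (Fin d) | 1/2 < ‖z - y‖} :=
        isOpen_lt (by fun_prop) (by fun_prop)
      exact (o1.inter o2).measurableSet
    have hν0 : ∀ z, 0 ≤ ν z := fun z => by rw [hν]; positivity
    have hpt : ∀ z ∈ {z : EuclideanSpace ℝ (Fin d) | 1/2 < ‖z - x‖ ∧ 1/2 < ‖z - y‖},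
        ν (x - z) * ν (z - y) ≤ K * K * 2 ^ g * (1 + ‖x - y‖) ^ (-g) *
        ((1 + ‖x - z‖) ^ (-g) + (1 + ‖z - y‖) ^ (-g)) := by
      rintro z ⟨hz1, hz2⟩
      rw [norm_sub_rev] at hz1
      have tri : ‖x - y‖ ≤ ‖x - z‖ + ‖z - y‖ := norm_sub_le_norm_sub_add_norm_sub x z y
      have p1 := wpos (x - z)
      have p2 := wpos (z - y)
      have p3 := wpos (x - y)
      calc ν (x - z) * ν (z - y)
          ≤ (K * (1 + ‖x - z‖) ^ (-g)) * (K * (1 + ‖z - y‖) ^ (-g)) :=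
            mul_le_mul (key2 _ hz1.le).2 (key2 _ hz2.le).2 (hν0 _) (by positivity)
        _ = K * K * ((1 + ‖x - z‖) ^ (-g) * (1 + ‖z - y‖) ^ (-g)) := by ring
        _ ≤ K * K * ((2 ^ g * (1 + ‖x - y‖) ^ (-g)) *
              ((1 + ‖x - z‖) ^ (-g) + (1 + ‖z - y‖) ^ (-g))) := by
            refine mul_le_mul_of_nonneg_left ?_ (by positivity)
            rcases le_total ‖x - z‖ ‖z - y‖ with h | h
            · have := w_double g ‖z - y‖ ‖x - y‖ hg (norm_nonneg _) (norm_nonneg _)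
                (by linarith)
              have q : 0 < 2 ^ g * (1 + ‖x - y‖) ^ (-g) := by positivity
              nlinarith
            · have := w_double g ‖x - z‖ ‖x - y‖ hg (norm_nonneg _) (norm_nonneg _)
                (by linarith)
              have q : 0 < 2 ^ g * (1 + ‖x - y‖) ^ (-g) := by positivity
              nlinarith
        _ = _ := by ring
    calc _ ≤ ∫ z in {z : EuclideanSpace ℝ (Fin d) | 1/2 < ‖z - x‖ ∧ 1/2 < ‖z - y‖},
          K * K * 2 ^ g * (1 + ‖x - y‖) ^ (-g) *
            ((1 + ‖x - z‖) ^ (-g) + (1 + ‖z - y‖) ^ (-g)) :=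
          integral_mono_of_nonneg
            (Filter.Eventually.of_forall fun z => mul_nonneg (hν0 _) (hν0 _))
            hF.integrableOn ((ae_restrict_iff' hS).2 (Filter.Eventually.of_forall hpt))
      _ ≤ ∫ z, K * K * 2 ^ g * (1 + ‖x - y‖) ^ (-g) *
            ((1 + ‖x - z‖) ^ (-g) + (1 + ‖z - y‖) ^ (-g)) :=
          setIntegral_le_integral hF (Filter.Eventually.of_forall fun z => by
            have p1 := wpos (x - z)
            have p2 := wpos (z - y)
            have p3 := wpos (x - y)
            simp only [Pi.zero_apply]
            positivity)
      _ = K * K * 2 ^ g * (1 + ‖x - y‖) ^ (-g) * (2 * I) := by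
          have e1 : ∫ z, (1 + ‖x - z‖) ^ (-g) = I := integral_sub_left_eq_self
            (fun z : EuclideanSpace ℝ (Fin d) => (1 + ‖z‖) ^ (-g)) volume x
          have e2 : ∫ z, (1 + ‖z - y‖) ^ (-g) = I := integral_sub_right_eq_self
            (fun z : EuclideanSpace ℝ (Fin d) => (1 + ‖z‖) ^ (-g)) y
          rw [integral_const_mul, integral_add i1 i2, e1, e2]
          ring
      _ ≤ K * K * 2 ^ g * ν (x - y) * (2 * I + 1) := by
          have p := hν0 (x - y)
          have hc : 0 ≤ K * K * 2 ^ g := by linarith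
          exact mul_le_mul (mul_le_mul_of_nonneg_left (key2 _ hxy').1 hc) (by linarith)
            (by linarith) (mul_nonneg hc p)
      _ = _ := by ring
end

section
/- Let d ≥ 1, α ∈ (0,2), and let κ : [0,∞) → (0,1] be non-increasing with κ(0) = 1 and κ(a) κ(b) ≤ C κ(a+b) for all a, b ≥ 0 and some constant C > 0. Define ν(x) = κ(|x|) |x|^{−d−α} for x ∈ ℝ^d \ {0}. Then ν satisfies conditions (A1), (A2) and (A3). -/
open MeasureTheory

/-- for `d ≥ 1`, `α ∈ (0,2)` and a non-increasing profile `κ : [0,∞) → (0,1]`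
with `κ(0) = 1` and `κ(a)κ(b) ≤ C κ(a+b)`, the jump intensity `ν(x) = κ(|x|) |x|^{-d-α}`
satisfies conditions (A1), (A2) and (A3). -/
theorem stmt4 (d : ℕ) (hd : 1 ≤ d) (α : ℝ) (hα0 : 0 < α) (hα2 : α < 2)
    (κ : ℝ → ℝ)
    (hκpos : ∀ s : ℝ, 0 ≤ s → 0 < κ s)
    (hκle1 : ∀ s : ℝ, 0 ≤ s → κ s ≤ 1)
    (hκmono : ∀ a b : ℝ, 0 ≤ a → a ≤ b → κ b ≤ κ a)
    (hκ0 : κ 0 = 1)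
    (C : ℝ) (hC : 0 < C)
    (hκmul : ∀ a b : ℝ, 0 ≤ a → 0 ≤ b → κ a * κ b ≤ C * κ (a + b))
    (ν : EuclideanSpace ℝ (Fin d) → ℝ)
    (hν : ∀ x : EuclideanSpace ℝ (Fin d), ν x = κ ‖x‖ * ‖x‖ ^ (-(d : ℝ) - α)) :
    -- condition (A1)
    (∀ r : ℝ, 0 < r → r ≤ 1/2 → ∃ C₁ : ℝ, 1 ≤ C₁ ∧
      ∀ x y : EuclideanSpace ℝ (Fin d), r ≤ ‖y‖ → ‖y‖ ≤ ‖x‖ → ‖x‖ ≤ ‖y‖ + 1 →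
        C₁⁻¹ * ν y ≤ ν x ∧ ν x ≤ C₁ * ν y) ∧
    -- condition (A2)
    (∃ C₂ : ℝ, 1 ≤ C₂ ∧
      ∀ x y : EuclideanSpace ℝ (Fin d), 1/2 ≤ ‖y‖ → ‖y‖ ≤ ‖x‖ → ν x ≤ C₂ * ν y) ∧
    -- condition (A3)
    (∃ C₃ : ℝ, 1 ≤ C₃ ∧
      ∀ x y : EuclideanSpace ℝ (Fin d), 1 ≤ ‖y - x‖ →
        ∫ z in {z : EuclideanSpace ℝ (Fin d) | 1/2 < ‖z - x‖ ∧ 1/2 < ‖z - y‖},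
          ν (x - z) * ν (z - y) ≤ C₃ * ν (x - y)) := by
  have hp : 0 < (d : ℝ) + α := by positivity
  have hpe : -(d : ℝ) - α = -((d : ℝ) + α) := by ring
  rw [hpe] at hν
  set p : ℝ := (d : ℝ) + α with hpdef
  have key2 : ∀ x y : EuclideanSpace ℝ (Fin d), 0 < ‖y‖ → ‖y‖ ≤ ‖x‖ → ν x ≤ ν y := by
    intro x y hy hxy
    rw [hν, hν]
    exact mul_le_mul (hκmono _ _ hy.le hxy)
      (Real.rpow_le_rpow_of_nonpos hy hxy (by linarith)) (by positivity) (hκpos _ hy.le).le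
  have hνnn : ∀ x, 0 ≤ ν x := by
    intro x
    rw [hν]
    exact mul_nonneg (hκpos _ (norm_nonneg _)).le (by positivity)
  refine ⟨?_, ?_, ?_⟩
  · intro r hr _
    have h1 := hκpos 1 (by norm_num)
    refine ⟨max 1 (C / κ 1 * (1 + 1 / r) ^ p), le_max_left _ _, ?_⟩
    intro x y hry hyx hxy
    have hy : 0 < ‖y‖ := by linarith
    have hM : (0 : ℝ) < max 1 (C / κ 1 * (1 + 1 / r) ^ p) := lt_max_of_lt_left one_pos
    constructor
    · rw [inv_mul_le_iff₀ hM]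
      refine le_trans ?_ (mul_le_mul_of_nonneg_right (le_max_right _ _) (hνnn x))
      rw [hν, hν]
      have a1 : κ ‖y‖ ≤ C / κ 1 * κ ‖x‖ := by
        rw [div_mul_eq_mul_div, le_div_iff₀ h1]
        refine (hκmul _ _ hy.le (by norm_num)).trans ?_
        exact mul_le_mul_of_nonneg_left (hκmono _ _ (by linarith) hxy) hC.le
      have a2 : ‖y‖ ^ (-p) ≤ (1 + 1 / r) ^ p * ‖x‖ ^ (-p) := by
        have hx : 0 < ‖x‖ := by linarith
        rw [Real.rpow_neg hy.le, Real.rpow_neg hx.le, ← div_eq_mul_inv,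
          ← Real.div_rpow (by positivity) hx.le, ← Real.inv_rpow hy.le]
        apply Real.rpow_le_rpow (by positivity) _ hp.le
        rw [le_div_iff₀ hx, inv_mul_le_iff₀ hy]
        have : 1 ≤ ‖y‖ * (1 / r) := by
          rw [mul_one_div, le_div_iff₀ hr]; linarith
        linarith
      calc _ ≤ (C / κ 1 * κ ‖x‖) * ((1 + 1 / r) ^ p * ‖x‖ ^ (-p)) :=
            mul_le_mul a1 a2 (by positivity)
              (mul_nonneg (by positivity) (hκpos _ (norm_nonneg _)).le)
        _ = _ := by ring
    · exact (key2 x y hy hyx).trans (le_mul_of_one_le_left (hνnn y) (le_max_left _ _))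
  · refine ⟨1, le_rfl, fun x y hy hyx => ?_⟩
    rw [one_mul]
    exact key2 x y (by linarith) hyx
  · set g : EuclideanSpace ℝ (Fin d) → ℝ := fun z => (1 + ‖z‖) ^ (-p) with hg
    have hgi : Integrable g := by
      apply integrable_one_add_norm
      simp [hpdef, hα0]
    have hg0 : ∀ z, 0 ≤ g z := fun z => by positivity
    set I : ℝ := ∫ z, g z with hI
    refine ⟨max 1 (C * 2 ^ p * 3 ^ p * (I + I)), le_max_left _ _, ?_⟩
    intro x y hxy
    rw [norm_sub_rev] at hxy
    have hR : 0 < ‖x - y‖ := by linarith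
    refine le_trans ?_ (mul_le_mul_of_nonneg_right (le_max_right _ _) (hνnn _))
    set K : ℝ := C * 2 ^ p * 3 ^ p * ν (x - y) with hK
    have hK0 : 0 ≤ K := mul_nonneg (by positivity) (hνnn _)
    have i1 : Integrable (fun z => g (z - x)) := hgi.comp_sub_right x
    have i2 : Integrable (fun z => g (z - y)) := hgi.comp_sub_right y
    have hGi : Integrable (fun z => K * (g (z - x) + g (z - y))) := (i1.add i2).const_mul K
    have hS : MeasurableSet
        {z : EuclideanSpace ℝ (Fin d) | 1/2 < ‖z - x‖ ∧ 1/2 < ‖z - y‖} := by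
      have m : ∀ w : EuclideanSpace ℝ (Fin d),
          MeasurableSet {z : EuclideanSpace ℝ (Fin d) | 1/2 < ‖z - w‖} := fun w =>
        measurableSet_lt measurable_const (measurable_id.sub_const w).norm
      exact (m x).inter (m y)
    have hg3 : ∀ z, 1/2 < ‖z‖ → ‖z‖ ^ (-p) ≤ 3 ^ p * g z := by
      intro z hz
      have hz0 : 0 < ‖z‖ := by linarith
      have h3 : (3 : ℝ) ^ p = (1 / 3) ^ (-p) := by
        rw [Real.rpow_neg (by norm_num), one_div, Real.inv_rpow (by norm_num), inv_inv]
      rw [h3, hg, ← Real.mul_rpow (by norm_num) (by positivity)]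
      exact Real.rpow_le_rpow_of_nonpos (by positivity) (by linarith) (by linarith)
    have bound : ∀ z, 1/2 < ‖z - x‖ → 1/2 < ‖z - y‖ →
        ν (x - z) * ν (z - y) ≤ K * (g (z - x) + g (z - y)) := by
      intro z hzx hzy
      have tri : ‖x - y‖ ≤ ‖z - x‖ + ‖z - y‖ := by
        rw [norm_sub_rev z x]
        exact norm_sub_le_norm_sub_add_norm_sub x z y
      rw [hK, hν, hν, hν, norm_sub_rev x z]
      have k1 : κ ‖z - x‖ * κ ‖z - y‖ ≤ C * κ ‖x - y‖ :=
        (hκmul _ _ (norm_nonneg _) (norm_nonneg _)).trans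
          (mul_le_mul_of_nonneg_left (hκmono _ _ hR.le tri) hC.le)
      have h2 : (2 : ℝ) ^ p * ‖x - y‖ ^ (-p) = (‖x - y‖ / 2) ^ (-p) := by
        rw [Real.div_rpow hR.le (by norm_num), Real.rpow_neg (by norm_num : (0:ℝ) ≤ 2),
          div_inv_eq_mul, mul_comm]
      have half : ∀ t : ℝ, ‖x - y‖ / 2 ≤ t → t ^ (-p) ≤ 2 ^ p * ‖x - y‖ ^ (-p) := by
        intro t ht
        rw [h2]
        exact Real.rpow_le_rpow_of_nonpos (by positivity) ht (by linarith)
      have gx := hg3 _ hzx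
      have gy := hg3 _ hzy
      have k2 : ‖z - x‖ ^ (-p) * ‖z - y‖ ^ (-p) ≤
          (2 ^ p * ‖x - y‖ ^ (-p)) * (3 ^ p * (g (z - x) + g (z - y))) := by
        have e1 : 0 ≤ 3 ^ p * g (z - x) := mul_nonneg (by positivity) (hg0 _)
        have e2 : 0 ≤ 3 ^ p * g (z - y) := mul_nonneg (by positivity) (hg0 _)
        rcases le_total (‖x - y‖ / 2) ‖z - x‖ with h | h
        · exact mul_le_mul (half _ h) (by linarith) (by positivity) (by positivity)
        · rw [mul_comm]
          exact mul_le_mul (half _ (by linarith)) (by linarith) (by positivity) (by positivity)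
      calc _ = (κ ‖z - x‖ * κ ‖z - y‖) * (‖z - x‖ ^ (-p) * ‖z - y‖ ^ (-p)) := by ring
        _ ≤ (C * κ ‖x - y‖) *
            ((2 ^ p * ‖x - y‖ ^ (-p)) * (3 ^ p * (g (z - x) + g (z - y)))) :=
          mul_le_mul k1 k2 (by positivity) (mul_nonneg hC.le (hκpos _ hR.le).le)
        _ = _ := by ring
    calc _ ≤ ∫ z in {z : EuclideanSpace ℝ (Fin d) | 1/2 < ‖z - x‖ ∧ 1/2 < ‖z - y‖},
            K * (g (z - x) + g (z - y)) := by
          apply integral_mono_of_nonneg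
          · exact Filter.Eventually.of_forall fun z => mul_nonneg (hνnn _) (hνnn _)
          · exact hGi.integrableOn
          · exact (ae_restrict_iff' hS).2 (Filter.Eventually.of_forall fun z hz =>
              bound z hz.1 hz.2)
      _ ≤ ∫ z, K * (g (z - x) + g (z - y)) :=
          setIntegral_le_integral hGi (Filter.Eventually.of_forall fun z =>
            mul_nonneg hK0 (add_nonneg (hg0 _) (hg0 _)))
      _ = K * (I + I) := by
          rw [integral_const_mul, integral_add i1 i2, integral_sub_right_eq_self g x,
            integral_sub_right_eq_self g y]
      _ = _ := by rw [hK]; ring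
end

section
/- Let d ≥ 1, a > 0, β ∈ (0,1], δ ∈ [0,2) and γ > (d+1)/2, and define ν(x) = e^{−a|x|^β} |x|^{−d−δ} (1 + |x|)^{d+δ−γ} for x ∈ ℝ^d \ {0}. Then ν satisfies conditions (A1), (A2) and (A3). -/
open MeasureTheory

lemma exp_poly_bound (p : ℝ) : ∃ C : ℝ, 0 < C ∧ ∀ x : ℝ, 0 ≤ x →
    Real.exp (-x) ≤ C * (1 + x) ^ (-p) := by
  obtain ⟨n, hn⟩ := exists_nat_ge p
  refine ⟨n.factorial * Real.exp 1, by positivity, fun x hx => ?_⟩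
  have h1 : (1 + x) ^ p ≤ (1 + x) ^ n := by
    rw [← Real.rpow_natCast]
    exact Real.rpow_le_rpow_of_exponent_le (by linarith) hn
  have h2 := Real.pow_div_factorial_le_exp (1 + x) (by linarith) n
  rw [div_le_iff₀ (by positivity), Real.exp_add] at h2
  have h3 : (1 + x) ^ p ≤ Real.exp 1 * Real.exp x * n.factorial := h1.trans h2
  rw [Real.rpow_neg (by linarith), Real.exp_neg, ← div_eq_mul_inv,
    le_div_iff₀ (by positivity), inv_mul_le_iff₀ (by positivity)]
  linarith

lemma gap_bound {β s u R : ℝ} (hβ0 : 0 < β) (hβ1 : β ≤ 1) (hs : 0 < s) (hsu : s ≤ u)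
    (hR0 : 0 ≤ R) (hR : R ≤ s + u) : (1 - β) * s ^ β ≤ s ^ β + u ^ β - R ^ β := by
  have hu : 0 < u := hs.trans_le hsu
  have h1 : R ^ β ≤ (s + u) ^ β := Real.rpow_le_rpow hR0 hR hβ0.le
  have h2 : (s + u) ^ β = u ^ β * (1 + s / u) ^ β := by
    rw [← Real.mul_rpow hu.le (by positivity)]
    congr 1; field_simp; ring
  have h3 : (1 + s / u) ^ β ≤ 1 + β * (s / u) :=
    rpow_one_add_le_one_add_mul_self (by have : 0 < s / u := by positivity
                                         linarith) hβ0.le hβ1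
  have h4 : u ^ β * (s / u) ≤ s ^ β := by
    have e1 : u ^ β * (s / u) = s * u ^ (β - 1) := by
      rw [Real.rpow_sub_one hu.ne']; field_simp
    have e2 : s ^ β = s * s ^ (β - 1) := by
      rw [Real.rpow_sub_one hs.ne']; field_simp
    rw [e1, e2]
    exact mul_le_mul_of_nonneg_left
      (Real.rpow_le_rpow_of_nonpos hs hsu (by linarith)) hs.le
  have h5 : u ^ β * (1 + s / u) ^ β ≤ u ^ β * (1 + β * (s / u)) :=
    mul_le_mul_of_nonneg_left h3 (by positivity)
  nlinarith [mul_le_mul_of_nonneg_left h4 hβ0.le]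

lemma scalar_lt {c β : ℝ} (hc : 0 < c) (hβ0 : 0 < β) (q : ℝ) (hq : 0 ≤ q) :
    ∃ C : ℝ, 0 < C ∧ ∀ s : ℝ, 1 / 2 < s → Real.exp (-(c * s ^ β)) ≤ C * (1 + s) ^ (-q) := by
  obtain ⟨C, hC, h⟩ := exp_poly_bound (q / β)
  refine ⟨C * (c ^ (-(q / β)) * (3 : ℝ) ^ q), by positivity, fun s hs => ?_⟩
  have hs0 : 0 < s := by linarith
  refine (h _ (by positivity)).trans ?_
  rw [mul_assoc]
  refine mul_le_mul_of_nonneg_left ?_ hC.le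
  have h1 : (1 + c * s ^ β) ^ (-(q / β)) ≤ (c * s ^ β) ^ (-(q / β)) :=
    Real.rpow_le_rpow_of_nonpos (by positivity) (by linarith)
      (by have : 0 ≤ q / β := by positivity
          linarith)
  have h2 : (c * s ^ β) ^ (-(q / β)) = c ^ (-(q / β)) * s ^ (-q) := by
    rw [Real.mul_rpow hc.le (by positivity), ← Real.rpow_mul hs0.le]
    congr 2; field_simp
  have h3 : s ^ (-q) ≤ 3 ^ q * (1 + s) ^ (-q) := by
    have : (3 * s) ^ (-q) ≤ (1 + s) ^ (-q) :=
      Real.rpow_le_rpow_of_nonpos (by positivity) (by linarith) (by linarith)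
    rw [Real.mul_rpow (by norm_num) hs0.le, Real.rpow_neg (by norm_num)] at this
    rwa [inv_mul_le_iff₀ (by positivity)] at this
  rw [h2] at h1
  refine h1.trans ?_
  rw [mul_assoc]
  exact mul_le_mul_of_nonneg_left h3 (by positivity)

lemma scalar_eq {a p γ : ℝ} (ha : 0 < a) (hp : 0 ≤ p) (hpγ : p ≤ γ) :
    ∃ C : ℝ, 0 < C ∧ ∀ s t m : ℝ, 1 / 2 < s → |t| ≤ s → 0 ≤ m → m ^ 2 ≤ s ^ 2 - t ^ 2 →
      Real.exp (-(a * (s - t))) * (1 + s) ^ (-γ)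
        ≤ C * ((1 + |t|) ^ (-(γ - p)) * (1 + m) ^ (-(2 * p))) := by
  obtain ⟨C, hC, h⟩ := exp_poly_bound p
  set κ := min 1 a / 4 with hκ
  have hκ0 : 0 < κ := by positivity
  refine ⟨C * κ ^ (-p), by positivity, fun s t m hs ht hm hq => ?_⟩
  have hs0 : 0 < s := by linarith
  have hts := abs_le.1 ht
  have hx : a * (m ^ 2 / (2 * s)) ≤ a * (s - t) := by
    refine mul_le_mul_of_nonneg_left ?_ ha.le
    rw [div_le_iff₀ (by positivity)]
    nlinarith
  have h1 : Real.exp (-(a * (s - t))) ≤ C * (1 + a * (m ^ 2 / (2 * s))) ^ (-p) :=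
    (Real.exp_le_exp.2 (neg_le_neg hx)).trans (h _ (by positivity))
  have h2 : κ * ((1 + m) ^ 2 / (1 + s)) ≤ 1 + a * (m ^ 2 / (2 * s)) := by
    have e : 1 + a * (m ^ 2 / (2 * s)) = (2 * s + a * m ^ 2) / (2 * s) := by field_simp
    rw [e, ← mul_div_assoc, div_le_div_iff₀ (by positivity) (by positivity)]
    have k1 : 4 * κ ≤ 1 := by rw [hκ]; linarith [min_le_left 1 a]
    have k2 : 4 * κ ≤ a := by rw [hκ]; linarith [min_le_right 1 a]
    have k3 : 2 * κ * (1 + m) ^ 2 ≤ 2 * s + a * m ^ 2 := by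
      have : (1 + m) ^ 2 ≤ 2 * (1 + m ^ 2) := by nlinarith [sq_nonneg (1 - m)]
      nlinarith [mul_le_mul_of_nonneg_left this hκ0.le, mul_le_mul_of_nonneg_right k2 (sq_nonneg m)]
    have : 0 ≤ κ * (1 + m) ^ 2 := by positivity
    nlinarith [mul_le_mul_of_nonneg_right k3 (by linarith : 0 ≤ 1 + s)]
  have h3 : (1 + a * (m ^ 2 / (2 * s))) ^ (-p) ≤
      κ ^ (-p) * ((1 + m) ^ (-(2 * p)) * (1 + s) ^ p) := by
    refine (Real.rpow_le_rpow_of_nonpos (by positivity) h2 (by linarith)).trans_eq ?_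
    clear_value κ
    rw [Real.mul_rpow hκ0.le (by positivity), Real.div_rpow (by positivity) (by positivity),
      ← Real.rpow_natCast, ← Real.rpow_mul (by positivity), Real.rpow_neg (by positivity : 0 ≤ 1 + s),
      div_inv_eq_mul]
    congr 3
    push_cast; ring
  have h4 : (1 + s) ^ p * (1 + s) ^ (-γ) ≤ (1 + |t|) ^ (-(γ - p)) := by
    rw [← Real.rpow_add (by positivity)]
    have : p + -γ = -(γ - p) := by ring
    rw [this]
    exact Real.rpow_le_rpow_of_nonpos (by positivity) (by linarith) (by linarith)
  calc Real.exp (-(a * (s - t))) * (1 + s) ^ (-γ)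
      ≤ (C * (κ ^ (-p) * ((1 + m) ^ (-(2 * p)) * (1 + s) ^ p))) * (1 + s) ^ (-γ) := by
        refine mul_le_mul_of_nonneg_right (h1.trans ?_) (by positivity)
        exact mul_le_mul_of_nonneg_left h3 hC.le
    _ = C * κ ^ (-p) * (((1 + s) ^ p * (1 + s) ^ (-γ)) * (1 + m) ^ (-(2 * p))) := by ring
    _ ≤ _ := by gcongr

lemma key (d : ℕ) (hd : 1 ≤ d) (a β γ : ℝ)
    (ha : 0 < a) (hβ0 : 0 < β) (hβ1 : β ≤ 1) (hγ : ((d : ℝ) + 1) / 2 < γ) :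
    ∃ K : ℝ, ∀ v : EuclideanSpace ℝ (Fin d), v ≠ 0 →
      ∃ g : EuclideanSpace ℝ (Fin d) → ℝ, (∀ w, 0 ≤ g w) ∧ Integrable g ∧ ∫ w, g w ≤ K ∧
        ∀ w, 1 / 2 < ‖w‖ → ‖w‖ ≤ ‖w - v‖ →
          Real.exp (-(a * (‖w‖ ^ β + ‖w - v‖ ^ β - ‖v‖ ^ β))) * (1 + ‖w‖) ^ (-γ) ≤ g w := by
  have hγ0 : 0 < γ := lt_trans (by positivity) hγ
  rcases hβ1.lt_or_eq with hlt | rfl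
  · obtain ⟨C, hC, h⟩ := scalar_lt (c := a * (1 - β)) (mul_pos ha (by linarith)) hβ0
      ((d : ℝ) + 1) (by positivity)
    refine ⟨∫ w : EuclideanSpace ℝ (Fin d), C * (1 + ‖w‖) ^ (-((d : ℝ) + 1)), fun v hv =>
      ⟨fun w => C * (1 + ‖w‖) ^ (-((d : ℝ) + 1)), fun w => by positivity, ?_, le_rfl, ?_⟩⟩
    · exact (integrable_one_add_norm (by simp)).const_mul C
    · intro w hw hwv
      have hg := gap_bound (R := ‖v‖) hβ0 hβ1 (by linarith : 0 < ‖w‖) hwv (norm_nonneg _)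
        (by have := norm_sub_le w (w - v); simpa using this)
      have h1 : (1 + ‖w‖) ^ (-γ) ≤ 1 :=
        Real.rpow_le_one_of_one_le_of_nonpos (by linarith) (by linarith)
      have h2 : Real.exp (-(a * (‖w‖ ^ β + ‖w - v‖ ^ β - ‖v‖ ^ β))) ≤
          Real.exp (-(a * (1 - β) * ‖w‖ ^ β)) := by
        rw [Real.exp_le_exp, neg_le_neg_iff, mul_assoc]
        exact mul_le_mul_of_nonneg_left hg ha.le
      calc _ ≤ Real.exp (-(a * (‖w‖ ^ β + ‖w - v‖ ^ β - ‖v‖ ^ β))) * 1 :=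
            mul_le_mul_of_nonneg_left h1 (Real.exp_pos _).le
        _ ≤ _ := by rw [mul_one]; exact h2.trans (h _ hw)
  · obtain ⟨D, rfl⟩ : ∃ D, d = D + 1 := ⟨d - 1, by omega⟩
    push_cast at hγ
    set p : ℝ := ((D : ℝ) / 2 + (γ - 1)) / 2 with hp
    have hp1 : (D : ℝ) < 2 * p := by rw [hp]; linarith
    have hp2 : 1 < γ - p := by rw [hp]; linarith
    have hp0 : 0 ≤ p := by have : (0 : ℝ) ≤ D := by positivity
                           linarith
    obtain ⟨C, hC, h⟩ := scalar_eq (a := a) (p := p) (γ := γ) ha hp0 (by linarith)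
    let G0 : ℝ × (Fin D → ℝ) → ℝ := fun q =>
      C * ((1 + ‖q.1‖) ^ (-(γ - p)) * (1 + ‖q.2‖) ^ (-(2 * p)))
    have hG0 : Integrable G0 := by
      refine Integrable.const_mul ?_ C
      exact Integrable.mul_prod (μ := (volume : Measure ℝ)) (ν := (volume : Measure (Fin D → ℝ)))
        (f := fun t : ℝ => (1 + ‖t‖) ^ (-(γ - p)))
        (g := fun t : Fin D → ℝ => (1 + ‖t‖) ^ (-(2 * p)))
        (integrable_one_add_norm (by simpa using hp2)) (integrable_one_add_norm (by simpa using hp1))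
    let S : EuclideanSpace ℝ (Fin (D + 1)) ≃ᵐ ℝ × (Fin D → ℝ) :=
      (MeasurableEquiv.toLp 2 (Fin (D + 1) → ℝ)).symm.trans
        (MeasurableEquiv.piFinSuccAbove (fun _ => ℝ) 0)
    have hS : MeasurePreserving S volume volume :=
      (volume_preserving_piFinSuccAbove (fun _ => ℝ) 0).comp
        (EuclideanSpace.volume_preserving_symm_measurableEquiv_toLp (Fin (D + 1)))
    refine ⟨∫ q, G0 q, fun v hv => ?_⟩
    have hvn : 0 < ‖v‖ := norm_pos_iff.2 hv
    set e : EuclideanSpace ℝ (Fin (D + 1)) := ‖v‖⁻¹ • v with he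
    have hen : ‖e‖ = 1 := by rw [he, norm_smul]; simp [hvn.ne']
    obtain ⟨b, hb⟩ := Orthonormal.exists_orthonormalBasis_extension_of_card_eq (𝕜 := ℝ)
      (E := EuclideanSpace ℝ (Fin (D + 1))) (ι := Fin (D + 1)) (by simp) (v := fun _ => e) (s := {0})
      (by
        constructor
        · intro i; simpa using hen
        · intro i j hij
          exact absurd (Subtype.ext (i.2.trans j.2.symm)) hij)
    have hb0 : b 0 = e := hb 0 rfl
    let T := b.repr.toMeasurableEquiv.trans S
    have hT : MeasurePreserving T volume volume := hS.comp b.measurePreserving_repr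
    refine ⟨fun w => G0 (T w), fun w => by positivity, ?_, ?_, ?_⟩
    · exact (hT.integrable_comp_emb T.measurableEmbedding).2 hG0
    · exact (hT.integral_comp' G0).le
    · intro w hw hwv
      have hT1 : (T w).1 = inner ℝ e w := by
        rw [← hb0, ← b.repr_apply_apply]; rfl
      have hT2 : ∀ i, (T w).2 i = b.repr w i.succ := fun i => rfl
      have hT1' : (T w).1 = b.repr w 0 := rfl
      have hsum : ‖w‖ ^ 2 = (T w).1 ^ 2 + ∑ i, (T w).2 i ^ 2 := by
        rw [← b.repr.norm_map w, EuclideanSpace.norm_sq_eq, Fin.sum_univ_succ]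
        simp [hT2, hT1']
      have hm : ‖(T w).2‖ ^ 2 ≤ ‖w‖ ^ 2 - (T w).1 ^ 2 := by
        rw [hsum, add_sub_cancel_left]
        have hsn : 0 ≤ ∑ i, (T w).2 i ^ 2 := Finset.sum_nonneg fun i _ => sq_nonneg _
        rw [← Real.le_sqrt (norm_nonneg _) hsn, pi_norm_le_iff_of_nonneg (Real.sqrt_nonneg _)]
        intro i
        refine Real.le_sqrt_of_sq_le ?_
        rw [Real.norm_eq_abs, sq_abs]
        exact Finset.single_le_sum (f := fun i => (T w).2 i ^ 2) (fun i _ => sq_nonneg _) (Finset.mem_univ i)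
      have ht : |(T w).1| ≤ ‖w‖ := by
        rw [hT1]
        have := abs_real_inner_le_norm e w
        rwa [hen, one_mul] at this
      have hmain := h ‖w‖ (T w).1 ‖(T w).2‖ hw ht (norm_nonneg _) hm
      refine le_trans ?_ hmain
      refine mul_le_mul_of_nonneg_right ?_ (by positivity)
      rw [Real.exp_le_exp, neg_le_neg_iff]
      refine mul_le_mul_of_nonneg_left ?_ ha.le
      simp only [Real.rpow_one]
      have h5 : inner ℝ e (v - w) ≤ ‖w - v‖ := by
        have := real_inner_le_norm e (v - w)
        rwa [hen, one_mul, norm_sub_rev] at this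
      have h6 : inner ℝ e v = ‖v‖ := by
        rw [he, real_inner_smul_left, real_inner_self_eq_norm_sq]; field_simp
      rw [inner_sub_right, h6] at h5
      rw [hT1]; linarith

/-- for `d ≥ 1`, `a > 0`, `β ∈ (0,1]`, `δ ∈ [0,2)` and `γ > (d+1)/2`,
the sub-exponentially localized jump intensity
`ν(x) = e^{-a|x|^β} |x|^{-d-δ} (1+|x|)^{d+δ-γ}` satisfies conditions (A1), (A2) and (A3). -/
theorem stmt5 (d : ℕ) (hd : 1 ≤ d) (a β δ γ : ℝ)
    (ha : 0 < a) (hβ0 : 0 < β) (hβ1 : β ≤ 1) (hδ0 : 0 ≤ δ) (hδ2 : δ < 2)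
    (hγ : ((d : ℝ) + 1) / 2 < γ)
    (ν : EuclideanSpace ℝ (Fin d) → ℝ)
    (hν : ∀ x : EuclideanSpace ℝ (Fin d),
      ν x = Real.exp (-(a * ‖x‖ ^ β)) * ‖x‖ ^ (-(d : ℝ) - δ) * (1 + ‖x‖) ^ ((d : ℝ) + δ - γ)) :
    -- condition (A1)
    (∀ r : ℝ, 0 < r → r ≤ 1/2 → ∃ C₁ : ℝ, 1 ≤ C₁ ∧
      ∀ x y : EuclideanSpace ℝ (Fin d), r ≤ ‖y‖ → ‖y‖ ≤ ‖x‖ → ‖x‖ ≤ ‖y‖ + 1 →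
        C₁⁻¹ * ν y ≤ ν x ∧ ν x ≤ C₁ * ν y) ∧
    -- condition (A2)
    (∃ C₂ : ℝ, 1 ≤ C₂ ∧
      ∀ x y : EuclideanSpace ℝ (Fin d), 1/2 ≤ ‖y‖ → ‖y‖ ≤ ‖x‖ → ν x ≤ C₂ * ν y) ∧
    -- condition (A3)
    (∃ C₃ : ℝ, 1 ≤ C₃ ∧
      ∀ x y : EuclideanSpace ℝ (Fin d), 1 ≤ ‖y - x‖ →
        ∫ z in {z : EuclideanSpace ℝ (Fin d) | 1/2 < ‖z - x‖ ∧ 1/2 < ‖z - y‖},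
          ν (x - z) * ν (z - y) ≤ C₃ * ν (x - y)) := by
  have hd0 : (0 : ℝ) < d := by exact_mod_cast hd
  have hγ0 : 0 < γ := lt_trans (by positivity) hγ
  let f : ℝ → ℝ := fun s => Real.exp (-(a * s ^ β)) * (1 + s) ^ (-γ)
  have hf0 : ∀ s, 0 ≤ s → 0 ≤ f s := fun s hs => by positivity
  have hν2 : ∀ x : EuclideanSpace ℝ (Fin d), x ≠ 0 → ν x = f ‖x‖ * ((1 + ‖x‖) / ‖x‖) ^ ((d : ℝ) + δ) := by
    intro x hx
    have hx0 : 0 < ‖x‖ := norm_pos_iff.2 hx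
    have e1 : -(d : ℝ) - δ = -((d : ℝ) + δ) := by ring
    have e2 : (d : ℝ) + δ - γ = -γ + ((d : ℝ) + δ) := by ring
    rw [hν, e1, e2, Real.rpow_neg hx0.le, Real.rpow_add (by positivity : 0 < 1 + ‖x‖),
      Real.div_rpow (by positivity) hx0.le]
    simp only [f, div_eq_mul_inv]
    ac_rfl
  have hlow : ∀ x : EuclideanSpace ℝ (Fin d), x ≠ 0 → f ‖x‖ ≤ ν x := by
    intro x hx
    have hx0 : 0 < ‖x‖ := norm_pos_iff.2 hx
    rw [hν2 x hx]
    refine le_mul_of_one_le_right (hf0 _ hx0.le) (Real.one_le_rpow ?_ (by positivity))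
    rw [le_div_iff₀ hx0]; linarith
  have hup : ∀ r : ℝ, 0 < r → ∀ x : EuclideanSpace ℝ (Fin d), r ≤ ‖x‖ →
      ν x ≤ ((1 + r) / r) ^ ((d : ℝ) + δ) * f ‖x‖ := by
    intro r hr x hx
    have hx0 : 0 < ‖x‖ := hr.trans_le hx
    rw [hν2 x (norm_pos_iff.1 hx0), mul_comm]
    refine mul_le_mul_of_nonneg_right (Real.rpow_le_rpow (by positivity) ?_ (by positivity))
      (hf0 _ hx0.le)
    rw [div_le_div_iff₀ hx0 hr]; nlinarith
  have hone : ∀ r : ℝ, 0 < r → 1 ≤ ((1 + r) / r) ^ ((d : ℝ) + δ) := by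
    intro r hr
    refine Real.one_le_rpow ?_ (by positivity)
    rw [le_div_iff₀ hr]; linarith
  have hanti : ∀ s t : ℝ, 0 ≤ s → s ≤ t → f t ≤ f s := by
    intro s t hs hst
    have h1 := Real.rpow_le_rpow hs hst hβ0.le
    have h2 : (1 + t) ^ (-γ) ≤ (1 + s) ^ (-γ) :=
      Real.rpow_le_rpow_of_nonpos (by positivity) (by linarith) (by linarith)
    have h3 : Real.exp (-(a * t ^ β)) ≤ Real.exp (-(a * s ^ β)) := by
      rw [Real.exp_le_exp, neg_le_neg_iff]
      exact mul_le_mul_of_nonneg_left h1 ha.le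
    exact mul_le_mul h3 h2 (Real.rpow_nonneg (by linarith) _) (Real.exp_pos _).le
  have hνpos : ∀ x : EuclideanSpace ℝ (Fin d), 0 ≤ ν x := fun x => by rw [hν]; positivity
  have hA2 : ∀ r : ℝ, 0 < r → ∀ x y : EuclideanSpace ℝ (Fin d), r ≤ ‖y‖ → ‖y‖ ≤ ‖x‖ →
      ν x ≤ ((1 + r) / r) ^ ((d : ℝ) + δ) * ν y := by
    intro r hr x y hy hyx
    have h0 := hone r hr
    refine (hup r hr x (hy.trans hyx)).trans (mul_le_mul_of_nonneg_left ?_ (by linarith))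
    exact (hanti _ _ (norm_nonneg _) hyx).trans (hlow y (norm_pos_iff.1 (hr.trans_le hy)))
  have hslow : ∀ s t : ℝ, 0 ≤ s → s ≤ t → t ≤ s + 1 → f s ≤ Real.exp a * 2 ^ γ * f t := by
    intro s t hs hst hts
    have ht : 0 ≤ t := hs.trans hst
    have h1 : t ^ β ≤ s ^ β + 1 := by
      refine (Real.rpow_le_rpow ht hts hβ0.le).trans ?_
      simpa using Real.rpow_add_le_add_rpow hs zero_le_one hβ0.le hβ1
    have h2 : Real.exp (-(a * s ^ β)) ≤ Real.exp a * Real.exp (-(a * t ^ β)) := by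
      rw [← Real.exp_add, Real.exp_le_exp]
      nlinarith
    have h3 : (1 + s) ^ (-γ) ≤ 2 ^ γ * (1 + t) ^ (-γ) := by
      have : (2 * (1 + s)) ^ (-γ) ≤ (1 + t) ^ (-γ) :=
        Real.rpow_le_rpow_of_nonpos (by positivity) (by linarith) (by linarith)
      rw [Real.mul_rpow (by norm_num) (by positivity), Real.rpow_neg (by norm_num),
        inv_mul_le_iff₀ (by positivity)] at this
      exact this
    calc f s ≤ (Real.exp a * Real.exp (-(a * t ^ β))) * (2 ^ γ * (1 + t) ^ (-γ)) :=
          mul_le_mul h2 h3 (by positivity) (by positivity)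
      _ = _ := by simp only [f]; ring
  refine ⟨?_, ⟨_, hone (1/2) (by norm_num), fun x y => hA2 (1/2) (by norm_num) x y⟩, ?_⟩
  · intro r hr _
    set c := ((1 + r) / r) ^ ((d : ℝ) + δ) with hc
    have hc1 : 1 ≤ c := hone r hr
    have hM : 1 ≤ Real.exp a * 2 ^ γ :=
      one_le_mul_of_one_le_of_one_le (Real.one_le_exp ha.le) (Real.one_le_rpow (by norm_num) hγ0.le)
    refine ⟨c * (Real.exp a * 2 ^ γ), one_le_mul_of_one_le_of_one_le hc1 hM,
      fun x y hy hyx hxy => ⟨?_, ?_⟩⟩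
    · rw [inv_mul_le_iff₀ (by positivity), mul_assoc]
      refine (hup r hr y hy).trans (mul_le_mul_of_nonneg_left ?_ (by linarith))
      refine (hslow _ _ (norm_nonneg _) hyx hxy).trans (mul_le_mul_of_nonneg_left ?_ (by linarith))
      exact hlow x (norm_pos_iff.1 (hr.trans_le (hy.trans hyx)))
    · refine (hA2 r hr x y hy hyx).trans ?_
      exact mul_le_mul_of_nonneg_right (le_mul_of_one_le_right (by linarith) hM) (hνpos y)
  · obtain ⟨K, hK⟩ := key d hd a β γ ha hβ0 hβ1 hγ
    set c := ((1 + (1/2 : ℝ)) / (1/2)) ^ ((d : ℝ) + δ) with hc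
    have hc1 : 1 ≤ c := hone (1/2) (by norm_num)
    -- pointwise bound
    have hpt : ∀ v w : EuclideanSpace ℝ (Fin d), v ≠ 0 → ∀ G : ℝ, 1/2 < ‖w‖ → ‖w‖ ≤ ‖w - v‖ →
        Real.exp (-(a * (‖w‖ ^ β + ‖w - v‖ ^ β - ‖v‖ ^ β))) * (1 + ‖w‖) ^ (-γ) ≤ G →
        f ‖w‖ * f ‖w - v‖ ≤ 2 ^ γ * f ‖v‖ * G := by
      intro v w hv G hw hwv hG
      have h1 : (1 + ‖w - v‖) ^ (-γ) ≤ 2 ^ γ * (1 + ‖v‖) ^ (-γ) := by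
        have htri : ‖v‖ ≤ ‖w‖ + ‖w - v‖ := by
          have := norm_sub_le w (w - v); simpa using this
        have : (2 * (1 + ‖w - v‖)) ^ (-γ) ≤ (1 + ‖v‖) ^ (-γ) :=
          Real.rpow_le_rpow_of_nonpos (by positivity) (by linarith) (by linarith)
        rw [Real.mul_rpow (by norm_num) (by positivity), Real.rpow_neg (by norm_num),
          inv_mul_le_iff₀ (by positivity)] at this
        exact this
      have h2 : Real.exp (-(a * ‖w‖ ^ β)) * Real.exp (-(a * ‖w - v‖ ^ β)) =
          Real.exp (-(a * ‖v‖ ^ β)) *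
            Real.exp (-(a * (‖w‖ ^ β + ‖w - v‖ ^ β - ‖v‖ ^ β))) := by
        rw [← Real.exp_add, ← Real.exp_add]; congr 1; ring
      calc f ‖w‖ * f ‖w - v‖ = (Real.exp (-(a * ‖w‖ ^ β)) * Real.exp (-(a * ‖w - v‖ ^ β))) *
            (1 + ‖w‖) ^ (-γ) * (1 + ‖w - v‖) ^ (-γ) := by simp only [f]; ring
        _ = Real.exp (-(a * ‖v‖ ^ β)) * (1 + ‖w - v‖) ^ (-γ) *
            (Real.exp (-(a * (‖w‖ ^ β + ‖w - v‖ ^ β - ‖v‖ ^ β))) * (1 + ‖w‖) ^ (-γ)) := by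
            rw [h2]; ring
        _ ≤ Real.exp (-(a * ‖v‖ ^ β)) * (2 ^ γ * (1 + ‖v‖) ^ (-γ)) * G := by gcongr
        _ = _ := by simp only [f]; ring
    refine ⟨max 1 (c * c * 2 ^ γ * (K + K)), le_max_left _ _, fun x y hxy => ?_⟩
    have hxy' : 1 ≤ ‖x - y‖ := by rwa [norm_sub_rev]
    have hne : y - x ≠ 0 := norm_pos_iff.1 (by linarith)
    have hne' : x - y ≠ 0 := norm_pos_iff.1 (by linarith)
    obtain ⟨g1, g1n, g1i, g1K, hg1⟩ := hK (y - x) hne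
    obtain ⟨g2, g2n, g2i, g2K, hg2⟩ := hK (x - y) hne'
    set B := c * c * 2 ^ γ * f ‖x - y‖ with hB
    have hB0 : 0 ≤ B := by
      have := hf0 _ (norm_nonneg (x - y))
      positivity
    have hHi : Integrable (fun z : EuclideanSpace ℝ (Fin d) => B * (g1 (z - x) + g2 (z - y))) :=
      ((g1i.comp_sub_right x).add (g2i.comp_sub_right y)).const_mul B
    have hHn : ∀ z : EuclideanSpace ℝ (Fin d), 0 ≤ B * (g1 (z - x) + g2 (z - y)) := fun z =>
      mul_nonneg hB0 (add_nonneg (g1n _) (g2n _))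
    have hmeas : MeasurableSet {z : EuclideanSpace ℝ (Fin d) | 1/2 < ‖z - x‖ ∧ 1/2 < ‖z - y‖} := by
      have m1 : Measurable fun z : EuclideanSpace ℝ (Fin d) => ‖z - x‖ := by fun_prop
      have m2 : Measurable fun z : EuclideanSpace ℝ (Fin d) => ‖z - y‖ := by fun_prop
      exact (measurableSet_lt measurable_const m1).inter (measurableSet_lt measurable_const m2)
    have hle : ∀ z ∈ {z : EuclideanSpace ℝ (Fin d) | 1/2 < ‖z - x‖ ∧ 1/2 < ‖z - y‖},
        ν (x - z) * ν (z - y) ≤ B * (g1 (z - x) + g2 (z - y)) := by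
      rintro z ⟨h1, h2⟩
      have e1 : z - x - (y - x) = z - y := by abel
      have e2 : z - y - (x - y) = z - x := by abel
      have u1 := hup (1/2) (by norm_num) (x - z) (by rw [norm_sub_rev]; exact h1.le)
      have u2 := hup (1/2) (by norm_num) (z - y) h2.le
      rw [norm_sub_rev] at u1
      have hff : f ‖z - x‖ * f ‖z - y‖ ≤ 2 ^ γ * f ‖x - y‖ * (g1 (z - x) + g2 (z - y)) := by
        have hpos : 0 ≤ 2 ^ γ * f ‖x - y‖ := by
          have := hf0 _ (norm_nonneg (x - y))
          positivity
        rcases le_total ‖z - x‖ ‖z - y‖ with hc | hc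
        · have := hpt (y - x) (z - x) hne _ h1 (by rwa [e1]) (hg1 _ h1 (by rwa [e1]))
          rw [e1, norm_sub_rev y x] at this
          refine this.trans (mul_le_mul_of_nonneg_left ?_ hpos)
          linarith [g2n (z - y)]
        · have := hpt (x - y) (z - y) hne' _ h2 (by rwa [e2]) (hg2 _ h2 (by rwa [e2]))
          rw [e2, mul_comm] at this
          refine this.trans (mul_le_mul_of_nonneg_left ?_ hpos)
          linarith [g1n (z - x)]
      calc ν (x - z) * ν (z - y) ≤ (c * f ‖z - x‖) * (c * f ‖z - y‖) :=
            mul_le_mul u1 u2 (hνpos _) (mul_nonneg (by linarith) (hf0 _ (norm_nonneg _)))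
        _ = c * c * (f ‖z - x‖ * f ‖z - y‖) := by ring
        _ ≤ c * c * (2 ^ γ * f ‖x - y‖ * (g1 (z - x) + g2 (z - y))) :=
            mul_le_mul_of_nonneg_left hff (by positivity)
        _ = _ := by rw [hB]; ring
    calc ∫ z in {z : EuclideanSpace ℝ (Fin d) | 1/2 < ‖z - x‖ ∧ 1/2 < ‖z - y‖}, ν (x - z) * ν (z - y)
        ≤ ∫ z in {z : EuclideanSpace ℝ (Fin d) | 1/2 < ‖z - x‖ ∧ 1/2 < ‖z - y‖}, B * (g1 (z - x) + g2 (z - y)) := by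
          refine integral_mono_of_nonneg
            (Filter.Eventually.of_forall fun z => mul_nonneg (hνpos _) (hνpos _))
            hHi.integrableOn ?_
          exact (ae_restrict_iff' hmeas).2 (Filter.Eventually.of_forall hle)
      _ ≤ ∫ z, B * (g1 (z - x) + g2 (z - y)) :=
          setIntegral_le_integral hHi (Filter.Eventually.of_forall hHn)
      _ = B * ((∫ z, g1 z) + ∫ z, g2 z) := by
          rw [integral_const_mul, integral_add (g1i.comp_sub_right x) (g2i.comp_sub_right y),
            integral_sub_right_eq_self g1 x, integral_sub_right_eq_self g2 y]
      _ ≤ B * (K + K) := mul_le_mul_of_nonneg_left (add_le_add g1K g2K) hB0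
      _ = c * c * 2 ^ γ * (K + K) * f ‖x - y‖ := by rw [hB]; ring
      _ ≤ max 1 (c * c * 2 ^ γ * (K + K)) * f ‖x - y‖ :=
          mul_le_mul_of_nonneg_right (le_max_right _ _) (hf0 _ (norm_nonneg _))
      _ ≤ _ := mul_le_mul_of_nonneg_left (hlow _ hne') (le_trans zero_le_one (le_max_left _ _))
end

section
/- Let d = 1, a > 0, δ ∈ [0,2), and define ν(x) = e^{−a|x|} |x|^{−1−δ} (1 + |x|)^{δ} for x ∈ ℝ \ {0} (this is the case β = 1, γ = (d+1)/2 = 1 of the sub-exponential family). Then ν does not satisfy condition (A3): for every constant C ≥ 1 there exist x, y ∈ ℝ with |y − x| ≥ 1 such that ∫_{{z : |z−x|>1/2, |z−y|>1/2}} ν(x−z) ν(z−y) dz > C ν(x−y). -/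
open MeasureTheory

theorem aux_eq (δ t : ℝ) (ht : 0 < t) :
    t ^ (-1 - δ) * (1 + t) ^ δ = t⁻¹ * ((1 + t) / t) ^ δ := by
  rw [Real.rpow_sub ht, Real.rpow_neg_one, Real.div_rpow (by positivity) ht.le]
  ring

theorem aux_lower (δ t : ℝ) (hδ : 0 ≤ δ) (ht : 0 < t) :
    t⁻¹ ≤ t ^ (-1 - δ) * (1 + t) ^ δ := by
  rw [aux_eq δ t ht]
  have : 1 ≤ ((1 + t) / t) ^ δ := by
    apply Real.one_le_rpow _ hδ
    rw [le_div_iff₀ ht]; linarith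
  have h2 : 0 < t⁻¹ := by positivity
  nlinarith

theorem aux_upper (δ t b : ℝ) (hδ : 0 ≤ δ) (hδ2 : δ < 2) (hb : 1 ≤ b) (ht : 0 < t)
    (htb : 1 + t ≤ b * t) :
    t ^ (-1 - δ) * (1 + t) ^ δ ≤ t⁻¹ * b ^ 2 := by
  rw [aux_eq δ t ht]
  have h1 : ((1 + t) / t) ^ δ ≤ b ^ δ := by
    apply Real.rpow_le_rpow (by positivity) _ hδ
    rwa [div_le_iff₀ ht]
  have h2 : b ^ δ ≤ b ^ (2 : ℝ) := Real.rpow_le_rpow_of_exponent_le hb hδ2.le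
  rw [Real.rpow_two] at h2
  exact mul_le_mul_of_nonneg_left (h1.trans h2) (by positivity)

theorem aux_exp (s : ℝ) : Real.exp (-|s|) ≤ 2 * (1 + s ^ 2)⁻¹ := by
  have h := Real.quadratic_le_exp_of_nonneg (abs_nonneg s)
  rw [Real.exp_neg, ← div_eq_mul_inv, le_div_iff₀ (by positivity), inv_mul_le_iff₀ (Real.exp_pos _)]
  have := sq_abs s
  have := abs_nonneg s
  nlinarith

/-- in dimension one, for `a > 0` and `δ ∈ [0,2)`, the exponentially localized
jump intensity `ν(x) = e^{-a|x|} |x|^{-1-δ} (1+|x|)^{δ}` (the case `β = 1`, `γ = 1` of the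
sub-exponential family) fails condition (A3): for every `C ≥ 1` there are `x, y ∈ ℝ` with
`|y-x| ≥ 1` whose convolution integral exceeds `C ν(x-y)`. -/
theorem stmt7 (a δ : ℝ) (ha : 0 < a) (hδ0 : 0 ≤ δ) (hδ2 : δ < 2)
    (ν : ℝ → ℝ)
    (hν : ∀ x : ℝ, ν x = Real.exp (-(a * |x|)) * |x| ^ (-1 - δ) * (1 + |x|) ^ δ) :
    ∀ C : ℝ, 1 ≤ C →
      ∃ x y : ℝ, 1 ≤ |y - x| ∧
        C * ν (x - y) <
          ∫ z in {z : ℝ | 1/2 < |z - x| ∧ 1/2 < |z - y|}, ν (x - z) * ν (z - y) := by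
  intro C hC
  have hnn : ∀ x, 0 ≤ ν x := by
    intro x; rw [hν]; positivity
  have hmeas : Measurable ν := by
    have : ν = fun x => Real.exp (-(a * |x|)) * |x| ^ (-1 - δ) * (1 + |x|) ^ δ := funext hν
    rw [this]
    have habs : Measurable (fun x : ℝ => |x|) := continuous_abs.measurable
    exact ((habs.const_mul a).neg.exp.mul (habs.pow_const _)).mul
      ((habs.const_add 1).pow_const _)
  have hlow : ∀ x, 0 < |x| → Real.exp (-(a * |x|)) * |x|⁻¹ ≤ ν x := by
    intro x hx
    rw [hν, mul_assoc]
    exact mul_le_mul_of_nonneg_left (aux_lower δ _ hδ0 hx) (Real.exp_pos _).le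
  have hup : ∀ x, 1 / 2 < |x| → ν x ≤ Real.exp (-(a * |x|)) * 18 := by
    intro x hx
    rw [hν, mul_assoc]
    refine mul_le_mul_of_nonneg_left ?_ (Real.exp_pos _).le
    have h := aux_upper δ |x| 3 hδ0 hδ2 (by norm_num) (by linarith) (by linarith)
    have h2 : |x|⁻¹ ≤ 2 := by
      rw [inv_le_comm₀ (by linarith) (by norm_num)]; linarith
    linarith
  set r : ℝ := 2 * Real.exp (4 * C + 1) with hr
  have hr2 : r / 2 = Real.exp (4 * C + 1) := by rw [hr]; ring
  have hr1 : 2 ≤ r := by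
    have := Real.add_one_le_exp (4 * C + 1)
    linarith
  have hr0 : 0 < r := by linarith
  refine ⟨0, r, by rw [sub_zero, abs_of_pos hr0]; linarith, ?_⟩
  have hS : MeasurableSet {z : ℝ | 1/2 < |z - 0| ∧ 1/2 < |z - r|} := by
    apply MeasurableSet.inter
    · exact measurableSet_lt measurable_const
        (continuous_abs.measurable.comp (measurable_id.sub_const 0))
    · exact measurableSet_lt measurable_const
        (continuous_abs.measurable.comp (measurable_id.sub_const r))
  have hint : IntegrableOn (fun z => ν (0 - z) * ν (z - r))
      {z : ℝ | 1/2 < |z - 0| ∧ 1/2 < |z - r|} := by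
    have hg : Integrable (fun z : ℝ => 648 * (1 + (a * z) ^ 2)⁻¹) :=
      (integrable_inv_one_add_sq.comp_mul_left' ha.ne').const_mul 648
    refine Integrable.mono' hg.integrableOn ?_ ?_
    · exact ((hmeas.comp (measurable_const.sub measurable_id)).mul
        (hmeas.comp (measurable_id.sub_const r))).aestronglyMeasurable
    · rw [ae_restrict_iff' hS]
      refine Filter.Eventually.of_forall fun z hz => ?_
      obtain ⟨h1, h2⟩ := hz
      rw [Real.norm_of_nonneg (mul_nonneg (hnn _) (hnn _))]
      rw [abs_sub_comm] at h1
      have k1 := hup _ h1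
      have k2 := hup _ h2
      have e2 : Real.exp (-(a * |z - r|)) ≤ 1 := by
        rw [Real.exp_le_one_iff]
        have : 0 ≤ a * |z - r| := by positivity
        linarith
      have e1 := aux_exp (a * z)
      rw [abs_mul, abs_of_pos ha] at e1
      rw [zero_sub, abs_neg] at k1
      rw [zero_sub]
      calc ν (-z) * ν (z - r) ≤ (Real.exp (-(a * |z|)) * 18) * 18 :=
            mul_le_mul k1 (by linarith) (hnn _) (by positivity)
        _ ≤ _ := by linarith
  have hsub : Set.Ioc 1 (r / 2) ⊆ {z : ℝ | 1/2 < |z - 0| ∧ 1/2 < |z - r|} := by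
    intro z hz
    obtain ⟨h1, h2⟩ := hz
    refine ⟨?_, ?_⟩
    · rw [sub_zero]; exact lt_of_lt_of_le (by linarith) (le_abs_self z)
    · rw [abs_sub_comm]; exact lt_of_lt_of_le (by linarith) (le_abs_self (r - z))
  have hstep1 := setIntegral_mono_set hint
    (Filter.Eventually.of_forall fun z => mul_nonneg (hnn _) (hnn _))
    (Filter.Eventually.of_forall hsub : Set.Ioc 1 (r / 2) ≤ᵐ[volume] _)
  have hlog : ∫ z in Set.Ioc 1 (r / 2), Real.exp (-(a * r)) * r⁻¹ * z⁻¹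
      = Real.exp (-(a * r)) * r⁻¹ * (4 * C + 1) := by
    rw [← intervalIntegral.integral_of_le (by linarith), intervalIntegral.integral_const_mul,
      integral_inv_of_pos one_pos (by linarith), div_one, hr2, Real.log_exp]
  have hi2 : IntegrableOn (fun z : ℝ => Real.exp (-(a * r)) * r⁻¹ * z⁻¹) (Set.Ioc 1 (r / 2)) := by
    by_contra hcon
    rw [integral_undef hcon] at hlog
    have : 0 < Real.exp (-(a * r)) * r⁻¹ * (4 * C + 1) := by positivity
    linarith
  have hstep2 := setIntegral_mono_on hi2 (hint.mono_set hsub) measurableSet_Ioc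
    (fun z hz => by
      obtain ⟨h1, h2⟩ := hz
      show Real.exp (-(a * r)) * r⁻¹ * z⁻¹ ≤ ν (0 - z) * ν (z - r)
      have hz0 : 0 < z := by linarith
      have hrz : 0 < r - z := by linarith
      have a1 : |0 - z| = z := by rw [zero_sub, abs_neg, abs_of_pos hz0]
      have a2 : |z - r| = r - z := by rw [abs_sub_comm, abs_of_pos hrz]
      have k1 := hlow (0 - z) (by rw [a1]; exact hz0)
      have k2 := hlow (z - r) (by rw [a2]; exact hrz)
      rw [a1] at k1
      rw [a2] at k2
      have k3 : r⁻¹ ≤ (r - z)⁻¹ := inv_anti₀ hrz (by linarith)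
      have k4 : Real.exp (-(a * r)) = Real.exp (-(a * z)) * Real.exp (-(a * (r - z))) := by
        rw [← Real.exp_add]; congr 1; ring
      calc Real.exp (-(a * r)) * r⁻¹ * z⁻¹
          = (Real.exp (-(a * z)) * z⁻¹) * (Real.exp (-(a * (r - z))) * r⁻¹) := by rw [k4]; ring
        _ ≤ (Real.exp (-(a * z)) * z⁻¹) * (Real.exp (-(a * (r - z))) * (r - z)⁻¹) := by gcongr
        _ ≤ _ := mul_le_mul k1 k2 (by positivity) (hnn _))
  rw [hlog] at hstep2
  refine lt_of_lt_of_le ?_ (hstep2.trans hstep1)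
  have a1 : |0 - r| = r := by rw [zero_sub, abs_neg, abs_of_pos hr0]
  have h := aux_upper δ r 2 hδ0 hδ2 (by norm_num) hr0 (by linarith)
  rw [hν, a1]
  have hp : 0 < Real.exp (-(a * r)) * r⁻¹ := by positivity
  have h5 := mul_le_mul_of_nonneg_left h (Real.exp_pos (-(a * r))).le
  calc C * (Real.exp (-(a * r)) * r ^ (-1 - δ) * (1 + r) ^ δ)
      ≤ C * (Real.exp (-(a * r)) * (r⁻¹ * 2 ^ 2)) := by
        rw [mul_assoc (Real.exp _)]
        exact mul_le_mul_of_nonneg_left h5 (by linarith)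
    _ = Real.exp (-(a * r)) * r⁻¹ * (4 * C) := by ring
    _ < _ := by nlinarith
end

section
/- Let (E, 𝔐, μ) be a σ-finite measure space and let u : E × E → [0,∞) be measurable and symmetric, i.e. u(x,y) = u(y,x) for all x, y. Let φ₀ : E → (0,∞) and suppose there are constants M, C > 0 such that u(x,y) ≤ M for all x, y ∈ E, and ∫_E u(x,y) dμ(y) ≤ C φ₀(x) for every x ∈ E. Then the threefold iterated kernel u⁽³⁾(x,y) = ∫_E ∫_E u(x,z) u(z,v) u(v,y) dμ(z) dμ(v) satisfies u⁽³⁾(x,y) ≤ M C² φ₀(x) φ₀(y) for all x, y ∈ E. -/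
open MeasureTheory

/-- kernel form of "ground state domination plus boundedness of the kernel
implies intrinsic ultracontractivity". If `u` is symmetric, `u ≤ M`, and
`∫ u(x,y) dμ(y) ≤ C φ₀(x)`, then the threefold iterated kernel satisfies
`u⁽³⁾(x,y) ≤ M C² φ₀(x) φ₀(y)`. (The integral bounds are phrased via the lower Lebesgue
integral, so that they assert in particular finiteness of the integrals.) -/
theorem stmt9 {E : Type*} [MeasurableSpace E] (μ : Measure E) [SigmaFinite μ]
    (u : E → E → ℝ) (humeas : Measurable (Function.uncurry u))
    (hunn : ∀ x y : E, 0 ≤ u x y)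
    (husymm : ∀ x y : E, u x y = u y x)
    (φ₀ : E → ℝ) (hφpos : ∀ x : E, 0 < φ₀ x)
    (M C : ℝ) (hM : 0 < M) (hC : 0 < C)
    (hbd : ∀ x y : E, u x y ≤ M)
    (hGSD : ∀ x : E, ∫⁻ y, ENNReal.ofReal (u x y) ∂μ ≤ ENNReal.ofReal (C * φ₀ x)) :
    ∀ x y : E,
      ∫⁻ v, (∫⁻ z, ENNReal.ofReal (u x z * u z v * u v y) ∂μ) ∂μ ≤
        ENNReal.ofReal (M * C ^ 2 * φ₀ x * φ₀ y) := by
  intro x y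
  have hm : ∀ a : E, Measurable fun z => ENNReal.ofReal (u a z) := fun a =>
    (humeas.comp measurable_prodMk_left).ennreal_ofReal
  have hpt : ∀ v z : E, ENNReal.ofReal (u x z * u z v * u v y) ≤
      (ENNReal.ofReal M * ENNReal.ofReal (u y v)) * ENNReal.ofReal (u x z) := by
    intro v z
    rw [← ENNReal.ofReal_mul hM.le, ← ENNReal.ofReal_mul (mul_nonneg hM.le (hunn y v))]
    apply ENNReal.ofReal_le_ofReal
    rw [husymm v y]
    have h := mul_le_mul_of_nonneg_left (hbd z v) (mul_nonneg (hunn x z) (hunn y v))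
    linarith
  calc ∫⁻ v, (∫⁻ z, ENNReal.ofReal (u x z * u z v * u v y) ∂μ) ∂μ
      ≤ ∫⁻ v, (∫⁻ z, (ENNReal.ofReal M * ENNReal.ofReal (u y v)) *
          ENNReal.ofReal (u x z) ∂μ) ∂μ :=
        lintegral_mono fun v => lintegral_mono fun z => hpt v z
    _ = ENNReal.ofReal M * (∫⁻ v, ENNReal.ofReal (u y v) ∂μ) *
          ∫⁻ z, ENNReal.ofReal (u x z) ∂μ := by
        simp_rw [lintegral_const_mul _ (hm x)]
        rw [lintegral_mul_const _ ((hm y).const_mul _), lintegral_const_mul _ (hm y)]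
    _ ≤ ENNReal.ofReal M * ENNReal.ofReal (C * φ₀ y) * ENNReal.ofReal (C * φ₀ x) := by
        gcongr
        · exact hGSD y
        · exact hGSD x
    _ = ENNReal.ofReal (M * C ^ 2 * φ₀ x * φ₀ y) := by
        rw [← ENNReal.ofReal_mul hM.le,
          ← ENNReal.ofReal_mul (mul_nonneg hM.le (mul_nonneg hC.le (hφpos y).le))]
        congr 1
        ring
end

section
/- Let d ≥ 1 and let ν : ℝ^d \ {0} → (0,∞) be measurable, with ν(−x) = ν(x), satisfying condition (A1). Let V : ℝ^d → ℝ be measurable with V(x) → ∞ as |x| → ∞, and suppose there are R_V > 1 and C₁₄ ≥ 1 such that V(y) ≤ C₁₄ V(x) whenever |x| > R_V and |y − x| < 1. Let t₀ > 0 and R > 0 be such that ν(x) < 1 for all |x| > R, the function x ↦ ν(x)(t₀ V(x) + log ν(x)) is integrable on every bounded Borel subset of {x : |x| > R}, and ∫_A ν(x) (t₀ V(x) + log ν(x)) dx ≥ 0 for every bounded Borel set A ⊆ {x : |x| > R}. Then there exists R₁ > R such that −log ν(x) ≤ 2 C₁₄ t₀ V(x) for every x with |x| > R₁. -/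
open MeasureTheory

/-- characterization of the borderline via the free energy functional.
If the free energy `F_A^{t₀V}(ν) = ∫_A ν (t₀ V + log ν) dx` is nonnegative for every
bounded Borel set `A ⊆ {|x| > R}`, then `-log ν(x) ≤ 2 C₁₄ t₀ V(x)` for all `|x| > R₁`
for some `R₁ > R`. -/
theorem stmt10 (d : ℕ) (hd : 1 ≤ d)
    (ν : EuclideanSpace ℝ (Fin d) → ℝ) (hνmeas : Measurable ν)
    (hνsymm : ∀ x : EuclideanSpace ℝ (Fin d), ν (-x) = ν x)
    (hνpos : ∀ x : EuclideanSpace ℝ (Fin d), x ≠ 0 → 0 < ν x)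
    -- condition (A1)
    (hA1 : ∀ r : ℝ, 0 < r → r ≤ 1/2 → ∃ C₁ : ℝ, 1 ≤ C₁ ∧
      ∀ x y : EuclideanSpace ℝ (Fin d), r ≤ ‖y‖ → ‖y‖ ≤ ‖x‖ → ‖x‖ ≤ ‖y‖ + 1 →
        C₁⁻¹ * ν y ≤ ν x ∧ ν x ≤ C₁ * ν y)
    (V : EuclideanSpace ℝ (Fin d) → ℝ) (hVmeas : Measurable V)
    -- `V(x) → ∞` as `|x| → ∞`
    (hVinf : ∀ M : ℝ, ∃ ρ : ℝ, ∀ x : EuclideanSpace ℝ (Fin d), ρ ≤ ‖x‖ → M ≤ V x)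
    (R_V C₁₄ : ℝ) (hRV : 1 < R_V) (hC₁₄ : 1 ≤ C₁₄)
    -- comparability of `V` on unit balls
    (hVcomp : ∀ x y : EuclideanSpace ℝ (Fin d), R_V < ‖x‖ → ‖y - x‖ < 1 → V y ≤ C₁₄ * V x)
    (t₀ R : ℝ) (ht₀ : 0 < t₀) (hR : 0 < R)
    (hνsmall : ∀ x : EuclideanSpace ℝ (Fin d), R < ‖x‖ → ν x < 1)
    -- local integrability of `ν (t₀ V + log ν)` outside `B(0,R)`
    (hint : ∀ A : Set (EuclideanSpace ℝ (Fin d)), MeasurableSet A → Bornology.IsBounded A →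
      A ⊆ {x | R < ‖x‖} →
      IntegrableOn (fun x => ν x * (t₀ * V x + Real.log (ν x))) A volume)
    -- nonnegativity of the free energy functional on all such sets
    (hfree : ∀ A : Set (EuclideanSpace ℝ (Fin d)), MeasurableSet A → Bornology.IsBounded A →
      A ⊆ {x | R < ‖x‖} →
      0 ≤ ∫ x in A, ν x * (t₀ * V x + Real.log (ν x))) :
    ∃ R₁ : ℝ, R < R₁ ∧ ∀ x : EuclideanSpace ℝ (Fin d), R₁ < ‖x‖ →
      -Real.log (ν x) ≤ 2 * C₁₄ * t₀ * V x := by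
  obtain ⟨C, hC1, hC⟩ := hA1 (1/2) (by norm_num) le_rfl
  obtain ⟨ρ, hρ⟩ := hVinf (Real.log C / (C₁₄ * t₀))
  have hCt : 0 < C₁₄ * t₀ := by positivity
  refine ⟨max (max (R + 1) R_V) (max ρ 2), ?_, ?_⟩
  · exact lt_of_lt_of_le (by linarith) ((le_max_left (R + 1) R_V).trans (le_max_left _ _))
  intro x hx
  simp only [max_lt_iff] at hx
  obtain ⟨⟨hxR, hxV⟩, hxρ, hx2⟩ := hx
  by_contra hcon
  push Not at hcon
  have hVx := hρ x hxρ.le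
  rw [div_le_iff₀ hCt] at hVx
  have hnorm : ∀ y ∈ Metric.ball x 1, |‖y‖ - ‖x‖| < 1 ∧ ‖y - x‖ < 1 := by
    intro y hy
    rw [mem_ball_iff_norm] at hy
    exact ⟨(abs_norm_sub_norm_le y x).trans_lt hy, hy⟩
  have hsub : Metric.ball x 1 ⊆ {x | R < ‖x‖} := by
    intro y hy
    have h := (abs_lt.1 (hnorm y hy).1).1
    show R < ‖y‖
    linarith
  have hneg : ∀ y ∈ Metric.ball x 1, ν y * (t₀ * V y + Real.log (ν y)) < 0 := by
    intro y hy
    obtain ⟨h1, h2⟩ := hnorm y hy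
    obtain ⟨h3, h4⟩ := abs_lt.1 h1
    have hx0 : 0 < ν x := hνpos x (norm_pos_iff.1 (by linarith))
    have hy0 : 0 < ν y := hνpos y (norm_pos_iff.1 (by linarith))
    have hle : ν y ≤ C * ν x := by
      rcases le_total ‖x‖ ‖y‖ with h | h
      · exact (hC y x (by linarith) h (by linarith)).2
      · have h5 := (hC x y (by linarith) h (by linarith)).1
        rwa [inv_mul_le_iff₀ (by linarith)] at h5
    have hlog := Real.log_le_log hy0 hle
    rw [Real.log_mul (by linarith) hx0.ne'] at hlog
    have hV := mul_le_mul_of_nonneg_left (hVcomp x y hxV h2) ht₀.le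
    apply mul_neg_of_pos_of_neg hy0
    nlinarith
  have hm : MeasurableSet (Metric.ball x (1:ℝ)) := measurableSet_ball
  have hi := hint _ hm Metric.isBounded_ball hsub
  have hf := hfree _ hm Metric.isBounded_ball hsub
  have hpos := (setIntegral_pos_iff_support_of_nonneg_ae
    (f := fun x => -(ν x * (t₀ * V x + Real.log (ν x))))
    ((ae_restrict_iff' hm).2 (Filter.Eventually.of_forall fun y hy => by
      have := hneg y hy
      simp only [Pi.zero_apply]
      linarith)) hi.neg).2 (by
      refine (Metric.measure_ball_pos volume x one_pos).trans_le (measure_mono ?_)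
      intro y hy
      exact ⟨neg_ne_zero.2 (hneg y hy).ne, hy⟩)
  rw [integral_neg] at hpos
  linarith
end

section
/- Let d ≥ 1, x₀ ∈ ℝ^d, ρ > 0 and D = B(x₀,ρ) the open Euclidean ball. Let k : D × D → [0,∞] be measurable, c ≥ 0, and let g : ℝ^d \ {0} → [0,∞) satisfy: g(z') ≥ g(z) whenever 0 < |z'| ≤ |z|, g(z) → ∞ as z → 0, and k(x,y) ≥ g(y−x) − c for all x, y ∈ D with x ≠ y. Then for every C > 0 there exists a nonnegative measurable function f on D with ∫_D f dx = 1 such that the set {x ∈ D : ∫_D k(x,y) f(y) dy > C} has positive Lebesgue measure. In particular, the integral operator f ↦ ∫_D k(·,y) f(y) dy is not bounded from L¹(D) to L^∞(D). -/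
open MeasureTheory
open scoped ENNReal

/-- a kernel on a ball dominating a radially non-increasing function that
blows up at the origin (minus a constant) is not bounded from `L¹(D)` to `L^∞(D)`: for
every `C > 0` there is a nonnegative `f` with `∫_D f = 1` such that `∫_D k(·,y) f(y) dy > C`
on a set of positive Lebesgue measure. -/
theorem stmt13 (d : ℕ) (hd : 1 ≤ d) (x₀ : EuclideanSpace ℝ (Fin d)) (ρ : ℝ) (hρ : 0 < ρ)
    (k : EuclideanSpace ℝ (Fin d) → EuclideanSpace ℝ (Fin d) → ℝ≥0∞)
    (hkmeas : Measurable (Function.uncurry k))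
    (c : ℝ) (hc : 0 ≤ c)
    (g : EuclideanSpace ℝ (Fin d) → ℝ)
    (hgnn : ∀ z : EuclideanSpace ℝ (Fin d), z ≠ 0 → 0 ≤ g z)
    -- `g(z') ≥ g(z)` whenever `0 < ‖z'‖ ≤ ‖z‖`
    (hgmono : ∀ z z' : EuclideanSpace ℝ (Fin d), z' ≠ 0 → ‖z'‖ ≤ ‖z‖ → g z ≤ g z')
    -- `g(z) → ∞` as `z → 0`
    (hgtend : Filter.Tendsto g (nhdsWithin 0 {(0 : EuclideanSpace ℝ (Fin d))}ᶜ) Filter.atTop)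
    -- `k(x,y) ≥ g(y-x) - c` on `D × D` off the diagonal
    (hkg : ∀ x ∈ Metric.ball x₀ ρ, ∀ y ∈ Metric.ball x₀ ρ, x ≠ y →
      ENNReal.ofReal (g (y - x) - c) ≤ k x y) :
    ∀ C : ℝ, 0 < C →
      ∃ f : EuclideanSpace ℝ (Fin d) → ℝ≥0∞, Measurable f ∧
        (∫⁻ y in Metric.ball x₀ ρ, f y) = 1 ∧
        0 < volume {x ∈ Metric.ball x₀ ρ |
          ENNReal.ofReal C < ∫⁻ y in Metric.ball x₀ ρ, k x y * f y} := by
  intro C hC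
  have : Nonempty (Fin d) := ⟨⟨0, hd⟩⟩
  have h1 := hgtend.eventually (Filter.eventually_ge_atTop (C + 1 + c))
  rw [eventually_nhdsWithin_iff, Metric.eventually_nhds_iff] at h1
  obtain ⟨δ, hδ, hg⟩ := h1
  set r := min (δ / 2) ρ with hr
  have hr0 : 0 < r := lt_min (by linarith) hρ
  have hrδ : r ≤ δ / 2 := min_le_left _ _
  have hsub : Metric.ball x₀ r ⊆ Metric.ball x₀ ρ := Metric.ball_subset_ball (min_le_right _ _)
  have hv0 : volume (Metric.ball x₀ r) ≠ 0 := (Metric.measure_ball_pos volume x₀ hr0).ne'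
  have hvt : volume (Metric.ball x₀ r) ≠ ∞ := measure_ball_lt_top.ne
  have hfm : Measurable ((Metric.ball x₀ r).indicator
      (fun _ => (volume (Metric.ball x₀ r))⁻¹)) :=
    measurable_const.indicator measurableSet_ball
  have hfi : (∫⁻ y in Metric.ball x₀ ρ, (Metric.ball x₀ r).indicator
      (fun _ => (volume (Metric.ball x₀ r))⁻¹) y) = 1 := by
    rw [setLIntegral_indicator measurableSet_ball, Set.inter_eq_left.mpr hsub,
      setLIntegral_const, ENNReal.inv_mul_cancel hv0 hvt]
  refine ⟨_, hfm, hfi, ?_⟩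
  refine lt_of_lt_of_le (pos_iff_ne_zero.mpr hv0) (measure_mono ?_)
  intro x hx
  refine ⟨hsub hx, ?_⟩
  have h2 : ENNReal.ofReal C < ENNReal.ofReal (C + 1) :=
    (ENNReal.ofReal_lt_ofReal_iff (by linarith)).mpr (by linarith)
  refine lt_of_lt_of_le h2 ?_
  calc ENNReal.ofReal (C + 1) = ENNReal.ofReal (C + 1) * 1 := (mul_one _).symm
    _ = ∫⁻ y in Metric.ball x₀ ρ, ENNReal.ofReal (C + 1) * (Metric.ball x₀ r).indicator
      (fun _ => (volume (Metric.ball x₀ r))⁻¹) y := by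
        rw [lintegral_const_mul _ hfm, hfi]
    _ ≤ _ := by
        apply lintegral_mono_ae
        have hne : ∀ᵐ y ∂(volume.restrict (Metric.ball x₀ ρ)), y ≠ x :=
          ae_restrict_of_ae (Measure.ae_ne volume x)
        filter_upwards [hne] with y hy
        by_cases hyr : y ∈ Metric.ball x₀ r
        · gcongr
          refine le_trans (ENNReal.ofReal_le_ofReal ?_) (hkg x (hsub hx) y (hsub hyr) hy.symm)
          have hd : dist (y - x) 0 < δ := by
            rw [dist_zero_right, ← dist_eq_norm]
            have := dist_triangle_right y x x₀
            rw [Metric.mem_ball] at hx hyr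
            linarith
          have := hg hd (sub_ne_zero.mpr hy)
          linarith
        · simp [hyr]
end
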